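/- For every integer n ≥ 2 there exists a constant c′₁ = c′₁(n), depending only on n, such that pp(D) ≤ c′₁ for every weakly connected digraph D satisfying conditions (D'1), (D2) and (D3). -/

import Mathlib

/-! ## Basic notions for graphs and digraphs

A digraph on a vertex type `V` is given by its arc relation `E : V → V → Prop`.
Simplicity and absence of 2-cycles is expressed by the hypothesis
`∀ u v, E u v → ¬ E v u`.  The underlying graph `G_D` is `SimpleGraph.fromRel E`. -/

/-- `G` contains an induced copy of the simple graph `H`. -/
def HasInducedCopyG {W V : Type} (H : SimpleGraph W) (G : SimpleGraph V) : Prop :=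
  ∃ f : W → V, Function.Injective f ∧ ∀ a b : W, G.Adj (f a) (f b) ↔ H.Adj a b

/-- The digraph `E` contains an induced copy of the digraph `H`. -/
def DigraphHasInducedCopy {W V : Type} (H : W → W → Prop) (E : V → V → Prop) : Prop :=
  ∃ f : W → V, Function.Injective f ∧ ∀ a b : W, E (f a) (f b) ↔ H a b

/-- The star `K_{1,n}` with one center and `n` leaves. -/
def StarG (n : ℕ) : SimpleGraph (Unit ⊕ Fin n) :=
  SimpleGraph.fromRel (fun a b =>
    match a, b with
    | Sum.inl _, Sum.inr _ => True
    | _, _ => False)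

/-- The path `P_n` of order `n`. -/
def PathG (n : ℕ) : SimpleGraph (Fin n) :=
  SimpleGraph.fromRel (fun i j => i.val + 1 = j.val)

/-- The graph `K*_n`: a complete graph on the `x_i` together with pendant edges `x_i y_i`. -/
def KStarG (n : ℕ) : SimpleGraph (Fin n ⊕ Fin n) :=
  SimpleGraph.fromRel (fun a b =>
    match a, b with
    | Sum.inl i, Sum.inl j => i ≠ j
    | Sum.inl i, Sum.inr j => i = j
    | _, _ => False)

/-- The graph `F^(1)_n` on `{x₁,x₂} ∪ {yᵢ} ∪ {zᵢ}`:
edges `x₁x₂, x₁y₁, x₁z₁` together with the two paths `y₁⋯y_n` and `z₁⋯z_n`. -/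
def F1G (n : ℕ) : SimpleGraph (Fin 2 ⊕ Fin n ⊕ Fin n) :=
  SimpleGraph.fromRel (fun a b =>
    match a, b with
    | Sum.inl i, Sum.inl j => i.val = 0 ∧ j.val = 1
    | Sum.inl i, Sum.inr (Sum.inl j) => i.val = 0 ∧ j.val = 0
    | Sum.inl i, Sum.inr (Sum.inr j) => i.val = 0 ∧ j.val = 0
    | Sum.inr (Sum.inl i), Sum.inr (Sum.inl j) => i.val + 1 = j.val
    | Sum.inr (Sum.inr i), Sum.inr (Sum.inr j) => i.val + 1 = j.val
    | _, _ => False)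

/-- The single edge `y₁z₁` (used to build `F^(2)_n` and `F^(4)_n`). -/
def YZEdgeG (n : ℕ) : SimpleGraph (Fin 2 ⊕ Fin n ⊕ Fin n) :=
  SimpleGraph.fromRel (fun a b =>
    match a, b with
    | Sum.inr (Sum.inl i), Sum.inr (Sum.inr j) => i.val = 0 ∧ j.val = 0
    | _, _ => False)

/-- `F^(2)_n = F^(1)_n + y₁z₁`. -/
def F2G (n : ℕ) : SimpleGraph (Fin 2 ⊕ Fin n ⊕ Fin n) := F1G n ⊔ YZEdgeG n

/-- The graph `F^(3)_n`: edges `x₁y₁, x₁z₁, x₂y₁, x₂z₁` together with the two paths. -/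
def F3G (n : ℕ) : SimpleGraph (Fin 2 ⊕ Fin n ⊕ Fin n) :=
  SimpleGraph.fromRel (fun a b =>
    match a, b with
    | Sum.inl _, Sum.inr (Sum.inl j) => j.val = 0
    | Sum.inl _, Sum.inr (Sum.inr j) => j.val = 0
    | Sum.inr (Sum.inl i), Sum.inr (Sum.inl j) => i.val + 1 = j.val
    | Sum.inr (Sum.inr i), Sum.inr (Sum.inr j) => i.val + 1 = j.val
    | _, _ => False)

/-- `F^(4)_n = F^(3)_n + y₁z₁`. -/
def F4G (n : ℕ) : SimpleGraph (Fin 2 ⊕ Fin n ⊕ Fin n) := F3G n ⊔ YZEdgeG n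

/-- The digraph `D^(1)_n` on `{x₁} ∪ {yᵢ} ∪ {zᵢ}` with arcs
`(x₁,y₁), (z₁,x₁), (y₁,z₁)`, `(y_{i+1}, y_i)` and `(z_i, z_{i+1})`. -/
def D1Rel (n : ℕ) : (Unit ⊕ Fin n ⊕ Fin n) → (Unit ⊕ Fin n ⊕ Fin n) → Prop := fun a b =>
  match a, b with
  | Sum.inl _, Sum.inr (Sum.inl j) => j.val = 0
  | Sum.inr (Sum.inr i), Sum.inl _ => i.val = 0
  | Sum.inr (Sum.inl i), Sum.inr (Sum.inr j) => i.val = 0 ∧ j.val = 0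
  | Sum.inr (Sum.inl i), Sum.inr (Sum.inl j) => j.val + 1 = i.val
  | Sum.inr (Sum.inr i), Sum.inr (Sum.inr j) => i.val + 1 = j.val
  | _, _ => False

/-- `D^(2)_n`: obtained from `D^(1)_n` by replacing the arc `(z₁,x₁)` by `(x₁,z₁)`. -/
def D2Rel (n : ℕ) : (Unit ⊕ Fin n ⊕ Fin n) → (Unit ⊕ Fin n ⊕ Fin n) → Prop := fun a b =>
  match a, b with
  | Sum.inl _, Sum.inr (Sum.inl j) => j.val = 0
  | Sum.inl _, Sum.inr (Sum.inr j) => j.val = 0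
  | Sum.inr (Sum.inl i), Sum.inr (Sum.inr j) => i.val = 0 ∧ j.val = 0
  | Sum.inr (Sum.inl i), Sum.inr (Sum.inl j) => j.val + 1 = i.val
  | Sum.inr (Sum.inr i), Sum.inr (Sum.inr j) => i.val + 1 = j.val
  | _, _ => False

/-- `D^(3)_n`: obtained from `D^(1)_n` by replacing the arc `(x₁,y₁)` by `(y₁,x₁)`. -/
def D3Rel (n : ℕ) : (Unit ⊕ Fin n ⊕ Fin n) → (Unit ⊕ Fin n ⊕ Fin n) → Prop := fun a b =>
  match a, b with
  | Sum.inr (Sum.inl i), Sum.inl _ => i.val = 0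
  | Sum.inr (Sum.inr i), Sum.inl _ => i.val = 0
  | Sum.inr (Sum.inl i), Sum.inr (Sum.inr j) => i.val = 0 ∧ j.val = 0
  | Sum.inr (Sum.inl i), Sum.inr (Sum.inl j) => j.val + 1 = i.val
  | Sum.inr (Sum.inr i), Sum.inr (Sum.inr j) => i.val + 1 = j.val
  | _, _ => False

/-- The transitive tournament `T_n`. -/
def TRel (n : ℕ) : Fin n → Fin n → Prop := fun i j => i < j

/-- A (nonempty) directed path in the digraph `E`, recorded as its list of vertices. -/
def IsDirPathList {V : Type} (E : V → V → Prop) (l : List V) : Prop :=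
  l ≠ [] ∧ l.Nodup ∧ l.Chain' E

/-- The path cover number of the subdigraph of `E` induced by `X`:
the minimum number of directed paths of `E[X]` whose vertex sets cover `X`. -/
noncomputable def pcOn {V : Type} (E : V → V → Prop) (X : Set V) : ℕ :=
  sInf {k | ∃ P : Finset (List V), P.card = k ∧
    (∀ l ∈ P, IsDirPathList E l ∧ ∀ v ∈ l, v ∈ X) ∧
    ∀ v ∈ X, ∃ l ∈ P, v ∈ l}

/-- The path partition number of the subdigraph of `E` induced by `X`:
the minimum number of pairwise vertex-disjoint directed paths of `E[X]`
whose vertex sets partition `X`. -/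
noncomputable def ppOn {V : Type} (E : V → V → Prop) (X : Set V) : ℕ :=
  sInf {k | ∃ P : Finset (List V), P.card = k ∧
    (∀ l ∈ P, IsDirPathList E l ∧ ∀ v ∈ l, v ∈ X) ∧
    (∀ v ∈ X, ∃ l ∈ P, v ∈ l) ∧
    ∀ l ∈ P, ∀ l' ∈ P, l ≠ l' → ∀ v ∈ l, v ∉ l'}

/-- A (nonempty) path in the simple graph `G`, recorded as its list of vertices. -/
def IsPathList {V : Type} (G : SimpleGraph V) (l : List V) : Prop :=
  l ≠ [] ∧ l.Nodup ∧ l.Chain' G.Adj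

/-- The path cover number `pc(G)` of a simple graph `G`. -/
noncomputable def pcG {V : Type} (G : SimpleGraph V) : ℕ :=
  sInf {k | ∃ P : Finset (List V), P.card = k ∧
    (∀ l ∈ P, IsPathList G l) ∧ ∀ v : V, ∃ l ∈ P, v ∈ l}

/-- The path partition number `pp(G)` of a simple graph `G`. -/
noncomputable def ppG {V : Type} (G : SimpleGraph V) : ℕ :=
  sInf {k | ∃ P : Finset (List V), P.card = k ∧
    (∀ l ∈ P, IsPathList G l) ∧ (∀ v : V, ∃ l ∈ P, v ∈ l) ∧
    ∀ l ∈ P, ∀ l' ∈ P, l ≠ l' → ∀ v ∈ l, v ∉ l'}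

/-- A directed cycle in the digraph `E`, recorded as its list of vertices. -/
def IsDirCycleList {V : Type} (E : V → V → Prop) (l : List V) : Prop :=
  ∃ h : l ≠ [], 3 ≤ l.length ∧ l.Nodup ∧ l.Chain' E ∧ E (l.getLast h) (l.head h)

/-- A member of a cycle cover/partition: a directed cycle, or a weakly connected
subdigraph of order at most two. -/
def IsCyclePartMember {V : Type} (E : V → V → Prop) (l : List V) : Prop :=
  IsDirCycleList E l ∨
    (l ≠ [] ∧ l.length ≤ 2 ∧ l.Nodup ∧ l.Chain' (fun a b => E a b ∨ E b a))

/-- The cycle partition number `cp(D)` of the digraph `E`. -/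
noncomputable def cpNum {V : Type} (E : V → V → Prop) : ℕ :=
  sInf {k | ∃ P : Finset (List V), P.card = k ∧
    (∀ l ∈ P, IsCyclePartMember E l) ∧
    (∀ v : V, ∃ l ∈ P, v ∈ l) ∧
    ∀ l ∈ P, ∀ l' ∈ P, l ≠ l' → ∀ v ∈ l, v ∉ l'}

/-- `v : Fin m → V` enumerates an induced path of the simple graph `G`. -/
def IsInducedPathEmb {V : Type} (G : SimpleGraph V) {m : ℕ} (v : Fin m → V) : Prop :=
  Function.Injective v ∧
    ∀ i j : Fin m, G.Adj (v i) (v j) ↔ (i.val + 1 = j.val ∨ j.val + 1 = i.val)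

/-- `w : Fin m → V` enumerates an induced pseudo-path of the digraph `E`:
the induced subdigraph on its image has a path as underlying graph. -/
def IsInducedPsPath {V : Type} (E : V → V → Prop) {m : ℕ} (w : Fin m → V) : Prop :=
  Function.Injective w ∧
    ∀ i j : Fin m, (E (w i) (w j) ∨ E (w j) (w i)) ↔ (i.val + 1 = j.val ∨ j.val + 1 = i.val)

/-- `r(P)` for a pseudo-path enumerated by `w`: the number of (internal) vertices
having out-degree 2 or in-degree 2 in the pseudo-path. -/
noncomputable def turnCount {V : Type} (E : V → V → Prop) {m : ℕ} (w : Fin m → V) : ℕ :=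
  Set.ncard {i : Fin m | ∃ j k : Fin m, j.val + 1 = i.val ∧ i.val + 1 = k.val ∧
    ((E (w i) (w j) ∧ E (w i) (w k)) ∨ (E (w j) (w i) ∧ E (w k) (w i)))}

/-- Condition (D1): the underlying graph of `E` is `{K*_n, K_{1,n}, F^(1)_n, F^(2)_n}`-free. -/
def CondD1 {V : Type} (n : ℕ) (E : V → V → Prop) : Prop :=
  ¬ HasInducedCopyG (KStarG n) (SimpleGraph.fromRel E) ∧
  ¬ HasInducedCopyG (StarG n) (SimpleGraph.fromRel E) ∧
  ¬ HasInducedCopyG (F1G n) (SimpleGraph.fromRel E) ∧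
  ¬ HasInducedCopyG (F2G n) (SimpleGraph.fromRel E)

/-- Condition (D'1): the underlying graph of `E` is
`{K*_n, K_{1,n}, F^(1)_n, F^(2)_n, F^(3)_n, F^(4)_n}`-free. -/
def CondD1' {V : Type} (n : ℕ) (E : V → V → Prop) : Prop :=
  CondD1 n E ∧
  ¬ HasInducedCopyG (F3G n) (SimpleGraph.fromRel E) ∧
  ¬ HasInducedCopyG (F4G n) (SimpleGraph.fromRel E)

/-- Condition (D2): `E` is `{D^(1)_n, D^(2)_n, D^(3)_n}`-free. -/
def CondD2 {V : Type} (n : ℕ) (E : V → V → Prop) : Prop :=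
  ¬ DigraphHasInducedCopy (D1Rel n) E ∧
  ¬ DigraphHasInducedCopy (D2Rel n) E ∧
  ¬ DigraphHasInducedCopy (D3Rel n) E

/-- Condition (D3): `r(P) ≤ n` for every induced pseudo-path `P` of `E`. -/
def CondD3 {V : Type} (n : ℕ) (E : V → V → Prop) : Prop :=
  ∀ (m : ℕ) (w : Fin m → V), IsInducedPsPath E w → turnCount E w ≤ n

/-- The Ramsey number `R(a, b)`: the least `R` such that every graph on at least `R`
vertices contains a clique of size `a` or an independent set of size `b`. -/
noncomputable def ramseyNumber (a b : ℕ) : ℕ :=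
  sInf {R | ∀ m : ℕ, R ≤ m → ∀ G : SimpleGraph (Fin m),
    (∃ s : Finset (Fin m), G.IsNClique a s) ∨ (∃ s : Finset (Fin m), Gᶜ.IsNClique b s)}

/-- The independence number of the subgraph of `G` induced by `X`. -/
noncomputable def indepNumOn {V : Type} (G : SimpleGraph V) (X : Set V) : ℕ :=
  sSup {k | ∃ s : Finset V, ↑s ⊆ X ∧ s.card = k ∧ ∀ a ∈ s, ∀ b ∈ s, a ≠ b → ¬ G.Adj a b}

/-- The independence number `α(G)`. -/
noncomputable def indepNum {V : Type} (G : SimpleGraph V) : ℕ := indepNumOn G Set.univ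

/-- The neighborhood `N_G(X)` of a set of vertices. -/
def nbhd {V : Type} (G : SimpleGraph V) (X : Set V) : Set V :=
  {v | v ∉ X ∧ ∃ x ∈ X, G.Adj v x}

/-! ## Bounded independence number -/

/-- Ramsey's theorem for two colours, for vertex subsets of arbitrary graphs. -/
theorem exists_clique_or_indepSet (a b : ℕ) : ∃ R : ℕ, ∀ (V : Type) (G : SimpleGraph V)
    (S : Finset V), R ≤ S.card →
      (∃ T ⊆ S, T.card = a ∧ G.IsClique (T : Set V)) ∨
      (∃ T ⊆ S, T.card = b ∧ G.IsIndepSet (T : Set V)) := by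
  classical
  induction a generalizing b with
  | zero => exact ⟨0, fun V G S _ => Or.inl ⟨∅, by simp⟩⟩
  | succ a iha =>
    induction b with
    | zero => exact ⟨0, fun V G S _ => Or.inr ⟨∅, by simp⟩⟩
    | succ b ihb =>
      obtain ⟨R₁, h₁⟩ := iha (b + 1)
      obtain ⟨R₂, h₂⟩ := ihb
      refine ⟨R₁ + R₂ + 1, fun V G S hS => ?_⟩
      obtain ⟨x, hx⟩ : S.Nonempty := Finset.card_pos.mp (by omega)
      have hcard := Finset.card_filter_add_card_filter_not (s := S.erase x) (fun y => G.Adj x y)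
      rw [Finset.card_erase_of_mem hx] at hcard
      by_cases hA : R₁ ≤ ((S.erase x).filter (fun y => G.Adj x y)).card
      · rcases h₁ V G _ hA with ⟨T, hTS, hT, hc⟩ | ⟨T, hTS, hT, hc⟩
        · have hadj : ∀ y ∈ T, G.Adj x y := fun y hy => (Finset.mem_filter.mp (hTS hy)).2
          have hxT : x ∉ T := fun h => (hadj x h).ne rfl
          refine Or.inl ⟨insert x T, ?_, by simp [hxT, hT], ?_⟩
          · intro y hy
            rcases Finset.mem_insert.mp hy with rfl | hy
            · exact hx
            · exact Finset.mem_of_mem_erase (Finset.mem_filter.mp (hTS hy)).1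
          · rw [Finset.coe_insert]
            exact hc.insert fun y hy _ => hadj y hy
        · exact Or.inr ⟨T, fun y hy =>
            Finset.mem_of_mem_erase (Finset.mem_filter.mp (hTS hy)).1, hT, hc⟩
      · rcases h₂ V G ((S.erase x).filter (fun y => ¬ G.Adj x y)) (by omega) with
          ⟨T, hTS, hT, hc⟩ | ⟨T, hTS, hT, hc⟩
        · exact Or.inl ⟨T, fun y hy =>
            Finset.mem_of_mem_erase (Finset.mem_filter.mp (hTS hy)).1, hT, hc⟩
        · have hadj : ∀ y ∈ T, ¬ G.Adj x y := fun y hy => (Finset.mem_filter.mp (hTS hy)).2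
          have hxT : x ∉ T := fun h =>
            Finset.notMem_erase x S (Finset.mem_filter.mp (hTS h)).1
          refine Or.inr ⟨insert x T, ?_, by simp [hxT, hT], ?_⟩
          · intro y hy
            rcases Finset.mem_insert.mp hy with rfl | hy
            · exact hx
            · exact Finset.mem_of_mem_erase (Finset.mem_filter.mp (hTS hy)).1
          · rw [Finset.coe_insert]
            exact Set.Pairwise.insert hc fun y hy _ => ⟨hadj y hy, fun h => hadj y hy h.symm⟩

/-- Every independent set of `G` inside `X` has at most `m` elements. -/
def IndepBound {V : Type} (G : SimpleGraph V) (X : Set V) (m : ℕ) : Prop :=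
  ∀ S : Finset V, (S : Set V) ⊆ X → G.IsIndepSet (S : Set V) → S.card ≤ m

theorem IndepBound.mono {V : Type} {G : SimpleGraph V} {X Y : Set V} {m : ℕ}
    (h : IndepBound G Y m) (hXY : X ⊆ Y) : IndepBound G X m :=
  fun S hS => h S (hS.trans hXY)

theorem indepBound_finset {V : Type} (G : SimpleGraph V) (Z : Finset V) :
    IndepBound G (Z : Set V) Z.card :=
  fun _ hS _ => Finset.card_le_card (by exact_mod_cast hS)

/-- In a star-free graph, a vertex is joined to few vertices of an independent set. -/
theorem card_filter_adj_lt {V : Type} {n : ℕ} {G : SimpleGraph V}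
    (hstar : ¬ HasInducedCopyG (StarG n) G) {S : Finset V} (hS : G.IsIndepSet (S : Set V))
    (x : V) [DecidablePred (G.Adj x)] : (S.filter (G.Adj x)).card < n := by
  by_contra! hcard
  obtain ⟨T, hTS, hT⟩ := Finset.exists_subset_card_eq hcard
  let e := T.equivFinOfCardEq hT
  have hadj : ∀ i, G.Adj x (e.symm i) := fun i => (Finset.mem_filter.mp (hTS (e.symm i).2)).2
  have hmem : ∀ i, (e.symm i : V) ∈ S := fun i => (Finset.mem_filter.mp (hTS (e.symm i).2)).1
  have hind : ∀ i j, ¬ G.Adj (e.symm i) (e.symm j) := fun i j h =>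
    hS (hmem i) (hmem j) h.ne h
  refine hstar ⟨Sum.elim (fun _ => x) (fun i => e.symm i), ?_, ?_⟩
  · rintro (i | i) (j | j) h
    · rfl
    · exact absurd h (hadj j).ne
    · exact absurd h.symm (hadj i).ne
    · simpa [Subtype.ext_iff] using h
  · rintro (i | i) (j | j)
    · simp [StarG]
    · simp [StarG, hadj j]
    · simp [StarG, (hadj i).symm]
    · simp [StarG, hind i j]

/-- In a `{K*_n, K_{1,n}}`-free graph, closed neighbourhoods of sets with bounded independence
number have bounded independence number. -/
theorem exists_indepBound_closedNeighborhood (n : ℕ) (hn : 2 ≤ n) (m : ℕ) :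
    ∃ M : ℕ, ∀ (V : Type) (G : SimpleGraph V),
      ¬ HasInducedCopyG (KStarG n) G → ¬ HasInducedCopyG (StarG n) G → ∀ X : Set V,
      IndepBound G X m → IndepBound G {v | ∃ x ∈ X, x = v ∨ G.Adj x v} M := by
  classical
  obtain ⟨R, hR⟩ := exists_clique_or_indepSet n (m + 1)
  refine ⟨R * n, fun V G hK hstar X hX S hSX hS => ?_⟩
  choose! dom hdomX hdom using fun v (hv : v ∈ S) => hSX hv
  -- a minimal set of vertices of `X` dominating `S`
  obtain ⟨Y, ⟨hYX, hYS⟩, hmin⟩ := exists_minimal_of_wellFoundedLT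
    (fun Y : Finset V => (Y : Set V) ⊆ X ∧ ∀ v ∈ S, ∃ x ∈ Y, x = v ∨ G.Adj x v)
    ⟨S.image dom, by
      intro x hx
      obtain ⟨v, hv, rfl⟩ := Finset.mem_image.mp (Finset.mem_coe.mp hx)
      exact hdomX v hv, fun v hv => ⟨dom v, Finset.mem_image_of_mem _ hv, hdom v hv⟩⟩
  have hpriv : ∀ x ∈ Y, ∃ v ∈ S, (x = v ∨ G.Adj x v) ∧
      ∀ y ∈ Y, y ≠ x → ¬ (y = v ∨ G.Adj y v) := by
    intro x hx
    by_contra! hcon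
    have := hmin (y := Y.erase x) ⟨fun y hy => hYX (Finset.mem_of_mem_erase hy), fun v hv => by
      obtain ⟨y, hy, hyv⟩ := hYS v hv
      by_cases hyx : y = x
      · subst hyx
        obtain ⟨z, hz, hzx, hzv⟩ := hcon v hv hyv
        exact ⟨z, Finset.mem_erase.mpr ⟨hzx, hz⟩, hzv⟩
      · exact ⟨y, Finset.mem_erase.mpr ⟨hyx, hy⟩, hyv⟩⟩ (Finset.erase_subset x Y) hx
    exact Finset.notMem_erase x Y this
  have hYR : Y.card < R := by
    by_contra! hcard
    rcases hR V G Y hcard with ⟨T, hTY, hT, hc⟩ | ⟨T, hTY, hT, hc⟩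
    · choose! p hpS hp hpp using hpriv
      let e := T.equivFinOfCardEq hT
      have hmem : ∀ i, (e.symm i : V) ∈ Y := fun i => hTY (e.symm i).2
      have hne : ∀ i j, i ≠ j → (e.symm i : V) ≠ e.symm j := fun i j hij h =>
        hij (e.symm.injective (Subtype.ext h))
      have hclique : ∀ i j, i ≠ j → G.Adj (e.symm i : V) (e.symm j) := fun i j hij =>
        hc (e.symm i).2 (e.symm j).2 (hne i j hij)
      have hoff : ∀ i j, i ≠ j → ¬ ((e.symm i : V) = p (e.symm j) ∨
          G.Adj (e.symm i : V) (p (e.symm j))) := fun i j hij =>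
        hpp _ (hmem j) _ (hmem i) (hne i j hij)
      have hself : ∀ i, (e.symm i : V) ≠ p (e.symm i) := by
        intro i hi
        obtain ⟨j, hj⟩ : ∃ j : Fin n, j ≠ i := by
          have : Nontrivial (Fin n) := Fin.nontrivial_iff_two_le.mpr hn
          exact exists_ne i
        exact hoff j i hj (Or.inr (hi ▸ hclique j i hj))
      have hadj : ∀ i, G.Adj (e.symm i : V) (p (e.symm i)) := fun i =>
        (hp _ (hmem i)).resolve_left (hself i)
      have hnot : ∀ i j, (e.symm i : V) ≠ p (e.symm j) := by
        intro i j
        by_cases hij : i = j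
        · exact hij ▸ hself i
        · exact fun h => hoff i j hij (Or.inl h)
      refine hK ⟨Sum.elim (fun i => e.symm i) (fun i => p (e.symm i)), ?_, ?_⟩
      · rintro (i | i) (j | j) h
        · simpa [Subtype.ext_iff] using h
        · exact absurd h (hnot i j)
        · exact absurd h.symm (hnot j i)
        · by_contra hij
          have hij : i ≠ j := fun h => hij (by rw [h])
          exact hoff i j hij (Or.inr ((show p (e.symm i) = p (e.symm j) from h) ▸ hadj i))
      · have hA : ∀ i j, G.Adj (e.symm i : V) (p (e.symm j)) ↔ i = j := fun i j =>
          ⟨fun h => by_contra fun hij => hoff i j hij (Or.inr h), fun h => h ▸ hadj i⟩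
        rintro (i | i) (j | j)
        · by_cases hij : i = j
          · simp [hij]
          · simp [KStarG, hij, hclique i j hij, Ne.symm hij]
        · simp [KStarG, hA]
        · simp [KStarG, G.adj_comm (p _), hA, eq_comm]
        · have : ¬ G.Adj (p (e.symm i)) (p (e.symm j)) := fun h =>
            hS (hpS _ (hmem i)) (hpS _ (hmem j)) h.ne h
          simp [KStarG, this]
    · have := hX T (fun x hx => hYX (hTY hx)) hc
      omega
  have hcover : S ⊆ Y.biUnion fun x => S.filter (fun v => x = v ∨ G.Adj x v) := by
    intro v hv
    obtain ⟨x, hx, hxv⟩ := hYS v hv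
    exact Finset.mem_biUnion.mpr ⟨x, hx, Finset.mem_filter.mpr ⟨hv, hxv⟩⟩
  refine (Finset.card_le_card hcover).trans ((Finset.card_biUnion_le_card_mul _ _ n ?_).trans
    (Nat.mul_le_mul_right n hYR.le))
  intro x _
  calc (S.filter (fun v => x = v ∨ G.Adj x v)).card
      ≤ (insert x (S.filter (G.Adj x))).card := by
        refine Finset.card_le_card fun v hv => ?_
        obtain ⟨hv, rfl | h⟩ := Finset.mem_filter.mp hv
        · simp
        · simp [hv, h]
    _ ≤ (S.filter (G.Adj x)).card + 1 := Finset.card_insert_le _ _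
    _ ≤ n := card_filter_adj_lt hstar hS x

/-- The vertices at distance at most `C` from `Z`. -/
def distBall {V : Type} (G : SimpleGraph V) (Z : Finset V) (C : ℕ) : Set V :=
  {v | ∃ z ∈ Z, G.dist z v ≤ C}

/-- A vertex other than `r` in a connected graph has a neighbour closer to `r`. -/
theorem exists_adj_dist_eq {V : Type} {G : SimpleGraph V} (hG : G.Connected) (r v : V) (k : ℕ)
    (hv : G.dist r v = k + 1) : ∃ u, G.Adj u v ∧ G.dist r u = k := by
  obtain ⟨p, hp⟩ := hG.exists_walk_length_eq_dist v r
  rw [SimpleGraph.dist_comm, hv] at hp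
  cases p with
  | nil => simp at hp
  | @cons _ u _ h q =>
    simp only [SimpleGraph.Walk.length_cons, Nat.add_right_cancel_iff] at hp
    have h₁ : G.dist r u ≤ k := by
      rw [SimpleGraph.dist_comm]
      exact hp ▸ SimpleGraph.dist_le q
    have h₂ := hG.dist_triangle (u := r) (v := u) (w := v)
    rw [SimpleGraph.dist_eq_one_iff_adj.mpr h.symm] at h₂
    exact ⟨u, h.symm, by omega⟩

theorem exists_indepBound_distBall (n : ℕ) (hn : 2 ≤ n) (N C : ℕ) :
    ∃ M : ℕ, ∀ (V : Type) (G : SimpleGraph V), G.Connected →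
      ¬ HasInducedCopyG (KStarG n) G → ¬ HasInducedCopyG (StarG n) G → ∀ Z : Finset V,
      Z.card ≤ N → IndepBound G (distBall G Z C) M := by
  induction C with
  | zero =>
    refine ⟨N, fun V G hG _ _ Z hZ S hS hind => ?_⟩
    refine (indepBound_finset G Z S (fun v hv => ?_) hind).trans hZ
    obtain ⟨z, hz, hzv⟩ := hS hv
    rw [Nat.le_zero, hG.dist_eq_zero_iff] at hzv
    exact hzv ▸ hz
  | succ C ih =>
    obtain ⟨M, hM⟩ := ih
    obtain ⟨M', hM'⟩ := exists_indepBound_closedNeighborhood n hn M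
    refine ⟨M', fun V G hG hK hstar Z hZ =>
      (hM' V G hK hstar _ (hM V G hG hK hstar Z hZ)).mono ?_⟩
    rintro v ⟨z, hz, hzv⟩
    rcases Nat.lt_or_ge C (G.dist z v) with hlt | hle
    · obtain ⟨u, huv, hu⟩ := exists_adj_dist_eq hG z v C (by omega)
      exact ⟨u, ⟨z, hz, hu.le⟩, Or.inr huv⟩
    · exact ⟨v, ⟨z, hz, hle⟩, Or.inl rfl⟩

/-! ## Path partitions and the Gallai–Milgram theorem -/

/-- `PathForest E X T`: the vertex set `X` is partitioned into directed paths of `E` whose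
set of final vertices is `T`. -/
inductive PathForest {V : Type} [DecidableEq V] (E : V → V → Prop) : Finset V → Finset V → Prop
  | empty : PathForest E ∅ ∅
  | single {X T : Finset V} (v : V) (hv : v ∉ X) (h : PathForest E X T) :
      PathForest E (insert v X) (insert v T)
  | extend {X T : Finset V} (u v : V) (hu : u ∈ T) (hv : v ∉ X) (huv : E u v)
      (h : PathForest E X T) : PathForest E (insert v X) (insert v (T.erase u))

namespace PathForest

variable {V : Type} [DecidableEq V] {E : V → V → Prop} {X T : Finset V}

theorem subset (h : PathForest E X T) : T ⊆ X := by
  induction h with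
  | empty => simp
  | single v _ _ ih => exact Finset.insert_subset_insert v ih
  | extend u v _ _ _ _ ih =>
    exact Finset.insert_subset_insert v ((Finset.erase_subset u _).trans ih)

theorem singletons (X : Finset V) : PathForest E X X := by
  induction X using Finset.induction_on with
  | empty => exact .empty
  | insert v X hv ih => exact .single v hv ih

/-- Removing the final vertex of a path either removes a whole path or uncovers the
predecessor of that vertex. -/
theorem erase (h : PathForest E X T) {v : V} (hv : v ∈ T) :
    PathForest E (X.erase v) (T.erase v) ∨
      ∃ u ∈ X, u ≠ v ∧ u ∉ T ∧ E u v ∧ PathForest E (X.erase v) (insert u (T.erase v)) := by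
  induction h with
  | empty => simp at hv
  | @single X T x hx h ih =>
    have hxT : x ∉ T := fun hxT => hx (h.subset hxT)
    by_cases hvx : v = x
    · subst hvx
      left
      rwa [Finset.erase_insert hx, Finset.erase_insert hxT]
    · rw [Finset.erase_insert_of_ne (Ne.symm hvx), Finset.erase_insert_of_ne (Ne.symm hvx)]
      have hx' : x ∉ X.erase v := fun h => hx (Finset.mem_of_mem_erase h)
      rcases ih ((Finset.mem_insert.mp hv).resolve_left hvx) with ih | ⟨u, huX, huv, huT, hE, ih⟩
      · exact Or.inl (.single x hx' ih)
      · refine Or.inr ⟨u, Finset.mem_insert_of_mem huX, huv, ?_, hE, ?_⟩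
        · rw [Finset.mem_insert, not_or]
          exact ⟨fun h => hx (h ▸ huX), huT⟩
        · rw [Finset.insert_comm]
          exact .single x hx' ih
  | @extend X T a b ha hb hab h ih =>
    have hne : a ≠ b := fun hab => hb (hab ▸ h.subset ha)
    have hbT : b ∉ T := fun hbT => hb (h.subset hbT)
    by_cases hvb : v = b
    · subst hvb
      refine Or.inr ⟨a, Finset.mem_insert_of_mem (h.subset ha), hne, by simp [hne], hab, ?_⟩
      rw [Finset.erase_insert hb, Finset.erase_insert
        (fun h => hbT (Finset.mem_of_mem_erase h)), Finset.insert_erase ha]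
      exact h
    · have hvT := (Finset.mem_insert.mp hv).resolve_left hvb
      have hva := Finset.ne_of_mem_erase hvT
      rw [Finset.erase_insert_of_ne (Ne.symm hvb), Finset.erase_insert_of_ne (Ne.symm hvb),
        Finset.erase_right_comm]
      have hb' : b ∉ X.erase v := fun h => hb (Finset.mem_of_mem_erase h)
      rcases ih (Finset.mem_of_mem_erase hvT) with ih | ⟨u, huX, huv, huT, hE, ih⟩
      · exact Or.inl (.extend a b (Finset.mem_erase.mpr ⟨Ne.symm hva, ha⟩) hb' hab ih)
      · have hua : u ≠ a := fun h => huT (h ▸ ha)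
        have hub : u ≠ b := fun h => hb (h ▸ huX)
        refine Or.inr ⟨u, Finset.mem_insert_of_mem huX, huv, ?_, hE, ?_⟩
        · simp [hub, huT]
        · have := PathForest.extend a b (Finset.mem_insert_of_mem
            (Finset.mem_erase.mpr ⟨Ne.symm hva, ha⟩)) hb' hab ih
          rwa [Finset.erase_insert_of_ne hua, Finset.insert_comm] at this

/-- A path forest with more paths than the independence number can be improved without
creating new final vertices. -/
theorem exists_card_lt {G : SimpleGraph V} (hGE : ∀ u v, G.Adj u v → E u v ∨ E v u) {k : ℕ}
    (h : PathForest E X T) (hX : IndepBound G (X : Set V) k) (hk : k < T.card) :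
    ∃ T' ⊆ T, T'.card + 1 = T.card ∧ PathForest E X T' := by
  induction hc : X.card using Nat.strong_induction_on generalizing X T with
  | _ c ih =>
    subst hc
    obtain ⟨u, hu, v, hv, huv, hE⟩ : ∃ u ∈ T, ∃ v ∈ T, u ≠ v ∧ E u v := by
      by_contra! hcon
      refine absurd (hX T (by exact_mod_cast h.subset) fun a ha b hb hab hadj => ?_) (by omega)
      rcases hGE a b hadj with he | he
      · exact hcon a ha b hb hab he
      · exact hcon b hb a ha hab.symm he
    have hvX := h.subset hv
    have huTv : u ∈ T.erase v := Finset.mem_erase.mpr ⟨huv, hu⟩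
    have hcT := Finset.card_erase_add_one hv
    have hcTu := Finset.card_erase_add_one hu
    have hswap : insert v ((T.erase v).erase u) = T.erase u := by
      rw [Finset.erase_right_comm]
      exact Finset.insert_erase (Finset.mem_erase.mpr ⟨huv.symm, hv⟩)
    have hfin : PathForest E (X.erase v) (T.erase v) →
        ∃ T' ⊆ T, T'.card + 1 = T.card ∧ PathForest E X T' := by
      intro h'
      have := PathForest.extend u v huTv (Finset.notMem_erase v X) hE h'
      rw [Finset.insert_erase hvX, hswap] at this
      exact ⟨_, Finset.erase_subset u T, hcTu, this⟩
    rcases h.erase hv with h' | ⟨w, hwX, hwv, hwT, hwE, h'⟩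
    · exact hfin h'
    · have hw' : w ∉ T.erase v := fun hw => hwT (Finset.mem_of_mem_erase hw)
      have hcard : (insert w (T.erase v)).card = T.card := by
        rw [Finset.card_insert_of_notMem hw', hcT]
      obtain ⟨T', hT', hcT', h''⟩ := ih _ (Finset.card_erase_lt_of_mem hvX) h'
        (hX.mono (by simp)) (by omega) rfl
      by_cases hwT' : w ∈ T'
      · have := PathForest.extend w v hwT' (Finset.notMem_erase v X) hwE h''
        rw [Finset.insert_erase hvX] at this
        refine ⟨_, ?_, ?_, this⟩
        · intro x hx
          rcases Finset.mem_insert.mp hx with rfl | hx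
          · exact hv
          · obtain ⟨hxw, hx⟩ := Finset.mem_erase.mp hx
            exact Finset.mem_of_mem_erase ((Finset.mem_insert.mp (hT' hx)).resolve_left hxw)
        · rw [Finset.card_insert_of_notMem, Finset.card_erase_add_one hwT', ← hcard, hcT']
          exact fun hx => Finset.notMem_erase v X (h''.subset (Finset.mem_of_mem_erase hx))
      · have hsub : T' ⊆ T.erase v := fun x hx =>
          (Finset.mem_insert.mp (hT' hx)).resolve_left fun hxw => hwT' (hxw ▸ hx)
        rw [Finset.eq_of_subset_of_card_le hsub (by omega)] at h''
        exact hfin h''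

/-- **Gallai–Milgram theorem**. -/
theorem exists_card_le {G : SimpleGraph V} (hGE : ∀ u v, G.Adj u v → E u v ∨ E v u) {k : ℕ}
    (hX : IndepBound G (X : Set V) k) : ∃ T, T.card ≤ k ∧ PathForest E X T := by
  obtain ⟨T, hT, hmin⟩ := exists_minimal_of_wellFoundedLT (fun T => PathForest E X T)
    ⟨X, singletons X⟩
  refine ⟨T, ?_, hT⟩
  by_contra! hk
  obtain ⟨T', hT', hcard, h'⟩ := hT.exists_card_lt hGE hX hk
  have := Finset.card_le_card (hmin h' hT')
  omega

/-- The directed paths forming a path forest. -/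
theorem exists_lists (h : PathForest E X T) : ∃ f : V → List V,
    (∀ t ∈ T, (f t).getLast? = some t ∧ (f t).Nodup ∧ (f t).IsChain E ∧ ∀ x ∈ f t, x ∈ X) ∧
    (∀ x ∈ X, ∃ t ∈ T, x ∈ f t) ∧
    ∀ t ∈ T, ∀ t' ∈ T, ∀ x, x ∈ f t → x ∈ f t' → t = t' := by
  induction h with
  | empty => exact ⟨fun _ => [], by simp⟩
  | @single X T v hv h ih =>
    obtain ⟨f, hf, hcov, hdis⟩ := ih
    have hne : ∀ t ∈ T, t ≠ v := fun t ht htv => hv (htv ▸ h.subset ht)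
    refine ⟨Function.update f v [v], ?_, ?_, ?_⟩
    · intro t ht
      rcases Finset.mem_insert.mp ht with rfl | ht
      · simp
      · rw [Function.update_of_ne (hne t ht)]
        obtain ⟨h₁, h₂, h₃, h₄⟩ := hf t ht
        exact ⟨h₁, h₂, h₃, fun x hx => Finset.mem_insert_of_mem (h₄ x hx)⟩
    · intro x hx
      rcases Finset.mem_insert.mp hx with rfl | hx
      · exact ⟨x, by simp, by simp⟩
      · obtain ⟨t, ht, hxt⟩ := hcov x hx
        exact ⟨t, Finset.mem_insert_of_mem ht, by rwa [Function.update_of_ne (hne t ht)]⟩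
    · intro t ht t' ht' x hx hx'
      rw [Finset.mem_insert] at ht ht'
      rcases ht with rfl | ht <;> rcases ht' with rfl | ht'
      · rfl
      · rw [Function.update_of_ne (hne t' ht')] at hx'
        simp only [Function.update_self, List.mem_singleton] at hx
        exact absurd ((hf t' ht').2.2.2 x hx') (hx ▸ hv)
      · rw [Function.update_of_ne (hne t ht)] at hx
        simp only [Function.update_self, List.mem_singleton] at hx'
        exact absurd ((hf t ht).2.2.2 x hx) (hx' ▸ hv)
      · rw [Function.update_of_ne (hne t ht)] at hx
        rw [Function.update_of_ne (hne t' ht')] at hx'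
        exact hdis t ht t' ht' x hx hx'
  | @extend X T u v hu hv huv h ih =>
    obtain ⟨f, hf, hcov, hdis⟩ := ih
    have hne : ∀ t ∈ T.erase u, t ≠ v := fun t ht htv =>
      hv (htv ▸ h.subset (Finset.mem_of_mem_erase ht))
    have hvf : ∀ t ∈ T, v ∉ f t := fun t ht h => hv ((hf t ht).2.2.2 v h)
    have hmix : ∀ t ∈ T.erase u, ∀ x ∈ f t, x ∉ f u ++ [v] := by
      intro t ht x hx hx'
      obtain ⟨htu, ht⟩ := Finset.mem_erase.mp ht
      rcases List.mem_append.mp hx' with hx' | hx'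
      · exact htu (hdis t ht u hu x hx hx')
      · rw [List.mem_singleton] at hx'
        exact hvf t ht (hx' ▸ hx)
    refine ⟨Function.update f v (f u ++ [v]), ?_, ?_, ?_⟩
    · intro t ht
      rcases Finset.mem_insert.mp ht with rfl | ht
      · obtain ⟨h₁, h₂, h₃, h₄⟩ := hf u hu
        rw [Function.update_self]
        refine ⟨by simp, ?_, ?_, ?_⟩
        · rw [List.nodup_append]
          refine ⟨h₂, by simp, ?_⟩
          intro a ha b hb hab
          rw [List.mem_singleton] at hb
          exact hvf u hu (hb ▸ hab ▸ ha)
        · rw [List.isChain_append]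
          refine ⟨h₃, by simp, ?_⟩
          simpa [h₁] using huv
        · intro x hx
          rcases List.mem_append.mp hx with hx | hx
          · exact Finset.mem_insert_of_mem (h₄ x hx)
          · simp_all
      · rw [Function.update_of_ne (hne t ht)]
        obtain ⟨h₁, h₂, h₃, h₄⟩ := hf t (Finset.mem_of_mem_erase ht)
        exact ⟨h₁, h₂, h₃, fun x hx => Finset.mem_insert_of_mem (h₄ x hx)⟩
    · intro x hx
      rcases Finset.mem_insert.mp hx with rfl | hx
      · exact ⟨x, by simp, by simp⟩
      · obtain ⟨t, ht, hxt⟩ := hcov x hx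
        by_cases htu : t = u
        · subst htu
          exact ⟨v, by simp, by simp [hxt]⟩
        · have ht' : t ∈ T.erase u := Finset.mem_erase.mpr ⟨htu, ht⟩
          exact ⟨t, Finset.mem_insert_of_mem ht', by rwa [Function.update_of_ne (hne t ht')]⟩
    · intro t ht t' ht' x hx hx'
      rw [Finset.mem_insert] at ht ht'
      rcases ht with rfl | ht <;> rcases ht' with rfl | ht'
      · rfl
      · rw [Function.update_of_ne (hne t' ht')] at hx'
        rw [Function.update_self] at hx
        exact absurd hx (hmix t' ht' x hx')
      · rw [Function.update_of_ne (hne t ht)] at hx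
        rw [Function.update_self] at hx'
        exact absurd hx' (hmix t ht x hx)
      · rw [Function.update_of_ne (hne t ht)] at hx
        rw [Function.update_of_ne (hne t' ht')] at hx'
        exact hdis t (Finset.mem_of_mem_erase ht) t' (Finset.mem_of_mem_erase ht') x hx hx'

end PathForest

/-- The vertex set `X` can be partitioned into at most `k` directed paths of `E`. -/
def HasPathPartition {V : Type} (E : V → V → Prop) (X : Set V) (k : ℕ) : Prop :=
  ∃ P : Finset (List V), P.card ≤ k ∧
    (∀ l ∈ P, IsDirPathList E l ∧ ∀ v ∈ l, v ∈ X) ∧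
    (∀ v ∈ X, ∃ l ∈ P, v ∈ l) ∧
    ∀ l ∈ P, ∀ l' ∈ P, l ≠ l' → ∀ v ∈ l, v ∉ l'

namespace HasPathPartition

variable {V : Type} {E : V → V → Prop}

theorem ppOn_le {X : Set V} {k : ℕ} (h : HasPathPartition E X k) : ppOn E X ≤ k := by
  obtain ⟨P, hk, hP⟩ := h
  exact le_trans (Nat.sInf_le (m := P.card) ⟨P, rfl, hP⟩) hk

theorem of_list {X : Set V} (l : List V) (hnd : l.Nodup) (hch : l.IsChain E)
    (hX : ∀ v, v ∈ l ↔ v ∈ X) : HasPathPartition E X 1 := by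
  rcases eq_or_ne l [] with rfl | hl
  · exact ⟨∅, by simp, by simp, fun v hv => absurd ((hX v).mpr hv) (by simp), by simp⟩
  · refine ⟨{l}, by simp, ?_, ?_, ?_⟩
    · simp only [Finset.mem_singleton, forall_eq]
      exact ⟨⟨hl, hnd, hch⟩, fun v hv => (hX v).mp hv⟩
    · exact fun v hv => ⟨l, by simp, (hX v).mpr hv⟩
    · simp

theorem union {X Y : Set V} {k m : ℕ} (hX : HasPathPartition E X k)
    (hY : HasPathPartition E Y m) (hXY : Disjoint X Y) : HasPathPartition E (X ∪ Y) (k + m) := by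
  classical
  obtain ⟨P, hPk, hP, hPc, hPd⟩ := hX
  obtain ⟨Q, hQm, hQ, hQc, hQd⟩ := hY
  rw [Set.disjoint_left] at hXY
  refine ⟨P ∪ Q, (Finset.card_union_le P Q).trans (by omega), ?_, ?_, ?_⟩
  · intro l hl
    rcases Finset.mem_union.mp hl with hl | hl
    · exact ⟨(hP l hl).1, fun v hv => Or.inl ((hP l hl).2 v hv)⟩
    · exact ⟨(hQ l hl).1, fun v hv => Or.inr ((hQ l hl).2 v hv)⟩
  · rintro v (hv | hv)
    · obtain ⟨l, hl, hvl⟩ := hPc v hv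
      exact ⟨l, Finset.mem_union_left _ hl, hvl⟩
    · obtain ⟨l, hl, hvl⟩ := hQc v hv
      exact ⟨l, Finset.mem_union_right _ hl, hvl⟩
  · intro l hl l' hl' hne v hv hv'
    rcases Finset.mem_union.mp hl with hl | hl <;> rcases Finset.mem_union.mp hl' with hl' | hl'
    · exact hPd l hl l' hl' hne v hv hv'
    · exact hXY ((hP l hl).2 v hv) ((hQ l' hl').2 v hv')
    · exact hXY ((hP l' hl').2 v hv') ((hQ l hl).2 v hv)
    · exact hQd l hl l' hl' hne v hv hv'

theorem mono {X : Set V} {k m : ℕ} (h : HasPathPartition E X k) (hkm : k ≤ m) :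
    HasPathPartition E X m :=
  h.imp fun _ hP => ⟨hP.1.trans hkm, hP.2⟩

theorem biUnion {ι : Type} (I : Finset ι) (X : ι → Set V) {k : ℕ}
    (hX : ∀ i ∈ I, HasPathPartition E (X i) k)
    (hdis : ∀ i ∈ I, ∀ j ∈ I, i ≠ j → Disjoint (X i) (X j)) :
    HasPathPartition E (⋃ i ∈ I, X i) (I.card * k) := by
  classical
  induction I using Finset.induction_on with
  | empty => exact ⟨∅, by simp, by simp, by simp, by simp⟩
  | insert i I hi ih =>
    rw [Finset.set_biUnion_insert, Finset.card_insert_of_notMem hi, Nat.succ_mul, Nat.add_comm]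
    refine (hX i (Finset.mem_insert_self i I)).union (ih
      (fun j hj => hX j (Finset.mem_insert_of_mem hj)) fun j hj k hk =>
        hdis j (Finset.mem_insert_of_mem hj) k (Finset.mem_insert_of_mem hk)) ?_
    simp only [Set.disjoint_iUnion_right]
    exact fun j hj => hdis i (Finset.mem_insert_self i I) j (Finset.mem_insert_of_mem hj)
      fun hij => hi (hij ▸ hj)

/-- **Gallai–Milgram theorem** for the subdigraph induced by a vertex set. -/
theorem of_indepBound [Fintype V] {G : SimpleGraph V} (hGE : ∀ u v, G.Adj u v → E u v ∨ E v u)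
    {X : Set V} {k : ℕ} (hX : IndepBound G X k) : HasPathPartition E X k := by
  classical
  obtain ⟨T, hT, hF⟩ := PathForest.exists_card_le (X := X.toFinset) hGE (hX.mono (by simp))
  obtain ⟨f, hf, hcov, hdis⟩ := hF.exists_lists
  refine ⟨T.image f, Finset.card_image_le.trans hT, ?_, ?_, ?_⟩
  · intro l hl
    obtain ⟨t, ht, rfl⟩ := Finset.mem_image.mp hl
    obtain ⟨h₁, h₂, h₃, h₄⟩ := hf t ht
    exact ⟨⟨fun h => by simp [h] at h₁, h₂, h₃⟩, fun v hv => by simpa using h₄ v hv⟩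
  · intro v hv
    obtain ⟨t, ht, hvt⟩ := hcov v (by simpa using hv)
    exact ⟨f t, Finset.mem_image_of_mem f ht, hvt⟩
  · intro l hl l' hl' hne v hv hv'
    obtain ⟨t, ht, rfl⟩ := Finset.mem_image.mp hl
    obtain ⟨t', ht', rfl⟩ := Finset.mem_image.mp hl'
    exact hne (congrArg f (hdis t ht t' ht' v hv hv'))

end HasPathPartition

/-- Rédei's theorem: a tournament has a Hamiltonian directed path. -/
theorem exists_hamiltonian_list {V : Type} [Fintype V] {E : V → V → Prop} {X : Set V}
    (hX : ∀ u ∈ X, ∀ v ∈ X, u ≠ v → E u v ∨ E v u) :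
    ∃ l : List V, l.Nodup ∧ l.IsChain E ∧ ∀ v, v ∈ l ↔ v ∈ X := by
  classical
  have hbound : IndepBound (SimpleGraph.fromRel E) X 1 := by
    intro S hS hind
    refine Finset.card_le_one.mpr fun a ha b hb => ?_
    by_contra hab
    exact hind ha hb hab ((SimpleGraph.fromRel_adj E a b).mpr ⟨hab, hX a (hS ha) b (hS hb) hab⟩)
  obtain ⟨P, hP, hPath, hcov, -⟩ := HasPathPartition.of_indepBound
    (fun u v h => ((SimpleGraph.fromRel_adj E u v).mp h).2) hbound
  rcases P.eq_empty_or_nonempty with rfl | ⟨l, hl⟩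
  · exact ⟨[], by simp, by simp, fun v => ⟨by simp, fun hv => by simpa using hcov v hv⟩⟩
  · obtain ⟨⟨-, hnd, hch⟩, hlX⟩ := hPath l hl
    refine ⟨l, hnd, hch, fun v => ⟨hlX v, fun hv => ?_⟩⟩
    obtain ⟨l', hl', hv'⟩ := hcov v hv
    exact Finset.card_le_one.mp hP l' hl' l hl ▸ hv'

/-! ## Geodesics from a root -/

/-- `w 0, …, w d` is a geodesic of `G` starting at `r`. -/
structure IsGeodesic {V : Type} (G : SimpleGraph V) (r : V) (w : ℕ → V) (d : ℕ) : Prop where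
  dist_eq : ∀ i ≤ d, G.dist r (w i) = i
  adj : ∀ i < d, G.Adj (w i) (w (i + 1))

theorem SimpleGraph.Connected.dist_le_of_adj {V : Type} {G : SimpleGraph V} (hG : G.Connected)
    (r : V) {u v : V} (h : G.Adj u v) :
    G.dist r u ≤ G.dist r v + 1 ∧ G.dist r v ≤ G.dist r u + 1 := by
  have h₁ := hG.dist_triangle (u := r) (v := u) (w := v)
  have h₂ := hG.dist_triangle (u := r) (v := v) (w := u)
  rw [SimpleGraph.dist_eq_one_iff_adj.mpr h] at h₁
  rw [SimpleGraph.dist_eq_one_iff_adj.mpr h.symm] at h₂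
  omega

namespace IsGeodesic

variable {V : Type} {G : SimpleGraph V} {r : V} {w : ℕ → V} {d : ℕ}

theorem eq_iff (hw : IsGeodesic G r w d) {i j : ℕ} (hi : i ≤ d) (hj : j ≤ d) :
    w i = w j ↔ i = j :=
  ⟨fun h => by rw [← hw.dist_eq i hi, h, hw.dist_eq j hj], fun h => h ▸ rfl⟩

theorem adj_iff (hG : G.Connected) (hw : IsGeodesic G r w d) {i j : ℕ} (hi : i ≤ d)
    (hj : j ≤ d) : G.Adj (w i) (w j) ↔ i + 1 = j ∨ j + 1 = i := by
  constructor
  · intro h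
    have := hG.dist_le_of_adj r h
    rw [hw.dist_eq i hi, hw.dist_eq j hj] at this
    have : i ≠ j := fun hij => h.ne (hij ▸ rfl)
    omega
  · rintro (rfl | rfl)
    · exact hw.adj i (by omega)
    · exact (hw.adj j (by omega)).symm

theorem ne_of_dist (hw : IsGeodesic G r w d) {v : V} (hv : v ≠ w (G.dist r v)) {j : ℕ}
    (hj : j ≤ d) : v ≠ w j := by
  rintro rfl
  rw [hw.dist_eq j hj] at hv
  exact hv rfl

theorem dist_le (hG : G.Connected) (hw : IsGeodesic G r w d) {i j : ℕ} (hij : i ≤ j)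
    (hj : j ≤ d) : G.dist (w i) (w j) ≤ j - i := by
  induction j, hij using Nat.le_induction with
  | base => simp
  | succ j hij ih =>
    have := (hG.dist_le_of_adj (w i) (hw.adj j (by omega))).2
    have := ih (by omega)
    omega

/-- Replacing an inner vertex of a geodesic. -/
theorem update (hw : IsGeodesic G r w d) {m : ℕ} (hm : m + 2 ≤ d) {v : V}
    (hv : G.dist r v = m + 1) (h₁ : G.Adj v (w m)) (h₂ : G.Adj v (w (m + 2))) :
    IsGeodesic G r (Function.update w (m + 1) v) d := by
  constructor
  · intro i hi
    rcases eq_or_ne i (m + 1) with rfl | h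
    · simpa using hv
    · simpa [h] using hw.dist_eq i hi
  · intro i hi
    rcases eq_or_ne i (m + 1) with rfl | h
    · simpa using h₂
    · rcases eq_or_ne i m with rfl | h'
      · simpa using h₁.symm
      · simpa [h, h'] using hw.adj i hi

theorem exists_of_dist (hG : G.Connected) (r : V) (k : ℕ) (v : V) (hv : G.dist r v = k) :
    ∃ w, IsGeodesic G r w k ∧ w k = v := by
  induction k generalizing v with
  | zero =>
    exact ⟨fun _ => v, ⟨fun i hi => by rw [hv]; omega, fun i hi => by omega⟩, rfl⟩
  | succ k ih =>
    obtain ⟨u, huv, hu⟩ := exists_adj_dist_eq hG r v k hv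
    obtain ⟨w, hw, hwu⟩ := ih u hu
    refine ⟨Function.update w (k + 1) v, ⟨fun i hi => ?_, fun i hi => ?_⟩, by simp⟩
    · rcases eq_or_ne i (k + 1) with rfl | h
      · simpa using hv
      · simpa [h] using hw.dist_eq i (by omega)
    · rcases eq_or_ne i k with rfl | h
      · simpa [hwu] using huv
      · have : i ≠ k + 1 := by omega
        simpa [h, this] using hw.adj i (by omega)

end IsGeodesic

/-! ## Forbidden induced subgraphs around a geodesic -/

section Forbidden

variable {V : Type} {G : SimpleGraph V} {r : V} {w : ℕ → V} {d n : ℕ}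

/-- The embedding of `F^(1)_n`, …, `F^(4)_n` and `D^(1)_n`, …, `D^(3)_n` whose two paths run
along `w`, downwards from `lo` and upwards from `hi`. -/
def twoTails {α : Type} (x : α → V) (w : ℕ → V) (lo hi : ℕ) (n : ℕ) : α ⊕ Fin n ⊕ Fin n → V :=
  Sum.elim x (Sum.elim (fun k => w (lo - k)) (fun k => w (hi + k)))

theorem twoTails_injective {α : Type} {x : α → V} (hw : IsGeodesic G r w d) {lo hi : ℕ}
    (hlo : n ≤ lo + 1) (hlohi : lo < hi) (hhi : hi + n ≤ d + 1) (hx : Function.Injective x)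
    (hxw : ∀ i, ∀ j ≤ d, (j ≤ lo ∨ hi ≤ j) → x i ≠ w j) :
    Function.Injective (twoTails x w lo hi n) := by
  rintro (i | i | i) (j | j | j) h <;> simp only [twoTails, Sum.elim_inl, Sum.elim_inr] at h
  · rw [hx h]
  · exact absurd h (hxw i _ (by omega) (by omega))
  · exact absurd h (hxw i _ (by omega) (by omega))
  · exact absurd h.symm (hxw j _ (by omega) (by omega))
  · rw [hw.eq_iff (by omega) (by omega)] at h
    rw [show i = j from Fin.ext (by omega)]
  · rw [hw.eq_iff (by omega) (by omega)] at h
    omega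
  · exact absurd h.symm (hxw j _ (by omega) (by omega))
  · rw [hw.eq_iff (by omega) (by omega)] at h
    omega
  · rw [hw.eq_iff (by omega) (by omega)] at h
    rw [show i = j from Fin.ext (by omega)]

theorem hasInducedCopyG_twoTails {α : Type} {x : α → V} (hG : G.Connected)
    (hw : IsGeodesic G r w d) {lo hi : ℕ} (hlo : n ≤ lo + 1) (hlohi : lo < hi)
    (hhi : hi + n ≤ d + 1) (hx : Function.Injective x)
    (hxw : ∀ i, ∀ j ≤ d, (j ≤ lo ∨ hi ≤ j) → x i ≠ w j)
    (H : SimpleGraph (α ⊕ Fin n ⊕ Fin n))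
    (hxx : ∀ i j, G.Adj (x i) (x j) ↔ H.Adj (.inl i) (.inl j))
    (hxy : ∀ i, ∀ k : Fin n, G.Adj (x i) (w (lo - k)) ↔ H.Adj (.inl i) (.inr (.inl k)))
    (hxz : ∀ i, ∀ k : Fin n, G.Adj (x i) (w (hi + k)) ↔ H.Adj (.inl i) (.inr (.inr k)))
    (hyy : ∀ k l : Fin n, H.Adj (.inr (.inl k)) (.inr (.inl l)) ↔
      k.val + 1 = l.val ∨ l.val + 1 = k.val)
    (hzz : ∀ k l : Fin n, H.Adj (.inr (.inr k)) (.inr (.inr l)) ↔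
      k.val + 1 = l.val ∨ l.val + 1 = k.val)
    (hyz : ∀ k l : Fin n, H.Adj (.inr (.inl k)) (.inr (.inr l)) ↔
      lo + 1 = hi ∧ k.val = 0 ∧ l.val = 0) : HasInducedCopyG H G := by
  refine ⟨twoTails x w lo hi n, twoTails_injective hw hlo hlohi hhi hx hxw, ?_⟩
  rintro (i | i | i) (j | j | j) <;> simp only [twoTails, Sum.elim_inl, Sum.elim_inr]
  · exact hxx i j
  · exact hxy i j
  · exact hxz i j
  · rw [G.adj_comm, H.adj_comm, hxy]
  · rw [hyy, hw.adj_iff hG (by omega) (by omega)]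
    omega
  · rw [hyz, hw.adj_iff hG (by omega) (by omega)]
    omega
  · rw [G.adj_comm, H.adj_comm, hxz]
  · rw [H.adj_comm, hyz, hw.adj_iff hG (by omega) (by omega)]
    omega
  · rw [hzz, hw.adj_iff hG (by omega) (by omega)]
    omega

/-- No vertex off the geodesic has a unique neighbour in the middle of the geodesic. -/
theorem not_forall_adj_iff_eq (hG : G.Connected) (hF : ¬ HasInducedCopyG (F1G n) G) (hn : 0 < n)
    (hw : IsGeodesic G r w d) {a : ℕ} (ha : n ≤ a) (had : a + n ≤ d) {v : V}
    (hvw : ∀ j ≤ d, v ≠ w j) : ¬ ∀ j ≤ d, G.Adj v (w j) ↔ j = a := by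
  intro hv
  have hav := (hv a (by omega)).mpr rfl
  have hne := hav.ne
  refine hF (hasInducedCopyG_twoTails (x := ![w a, v]) (lo := a - 1) (hi := a + 1) hG hw
    (by omega) (by omega) (by omega) ?_ ?_ _ ?_ ?_ ?_ ?_ ?_ ?_)
  · intro i j h
    fin_cases i <;> fin_cases j <;> simp_all
  · intro i j hj hja
    fin_cases i
    · exact fun h => by have := (hw.eq_iff (by omega) hj).mp h; omega
    · exact hvw j hj
  · intro i j
    fin_cases i <;> fin_cases j <;> simp [F1G, hav, hav.symm]
  · intro i k
    fin_cases i
    · simp [F1G, hw.adj_iff hG (show a ≤ d by omega) (show a - 1 - k ≤ d by omega)]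
      omega
    · simp [F1G, hv _ (show a - 1 - k ≤ d by omega)]
      omega
  · intro i k
    fin_cases i
    · simp [F1G, hw.adj_iff hG (show a ≤ d by omega) (show a + 1 + k ≤ d by omega)]
      omega
    · simp [F1G, hv _ (show a + 1 + k ≤ d by omega)]
      omega
  · intro k l
    simp [F1G]
    omega
  · intro k l
    simp [F1G]
    omega
  · intro k l
    simp [F1G]
    omega

/-- If `v` is joined to exactly two consecutive vertices in the middle of a geodesic, then its
neighbours are joined to the geodesic. -/
theorem exists_adj_of_adj_of_triangle (hG : G.Connected) (hF : ¬ HasInducedCopyG (F2G n) G)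
    (hw : IsGeodesic G r w d) {a : ℕ} (ha : n ≤ a) (had : a + n + 1 ≤ d) {u v : V}
    (hvw : ∀ j ≤ d, v ≠ w j) (hv : ∀ j ≤ d, G.Adj v (w j) ↔ j = a ∨ j = a + 1)
    (huw : ∀ j ≤ d, u ≠ w j) (huv : G.Adj v u) : ∃ j ≤ d, G.Adj u (w j) := by
  by_contra! hu
  have hne := huv.ne
  refine hF (hasInducedCopyG_twoTails (x := ![v, u]) (lo := a) (hi := a + 1) hG hw
    (by omega) (by omega) (by omega) ?_ ?_ _ ?_ ?_ ?_ ?_ ?_ ?_)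
  · intro i j h
    fin_cases i <;> fin_cases j <;> simp_all
  · intro i j hj hja
    fin_cases i
    · exact hvw j hj
    · exact huw j hj
  · intro i j
    fin_cases i <;> fin_cases j <;> simp [F2G, F1G, YZEdgeG, huv, huv.symm]
  · intro i k
    fin_cases i
    · simp [F2G, F1G, YZEdgeG, hv _ (show a - k ≤ d by omega)]
      omega
    · simp [F2G, F1G, YZEdgeG, hu _ (show a - k ≤ d by omega)]
  · intro i k
    fin_cases i
    · simp [F2G, F1G, YZEdgeG, hv _ (show a + 1 + k ≤ d by omega)]
      omega
    · simp [F2G, F1G, YZEdgeG, hu _ (show a + 1 + k ≤ d by omega)]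
  · intro k l
    simp [F2G, F1G, YZEdgeG]
    omega
  · intro k l
    simp [F2G, F1G, YZEdgeG]
    omega
  · intro k l
    simp [F2G, F1G, YZEdgeG]

/-- No vertex is joined to exactly two vertices at distance two in the middle of a geodesic. -/
theorem not_forall_adj_iff_or_add_two (hG : G.Connected) (hF : ¬ HasInducedCopyG (F3G n) G)
    (hw : IsGeodesic G r w d) {a : ℕ} (ha : n ≤ a) (had : a + n + 2 ≤ d) {v : V}
    (hvw : ∀ j ≤ d, v ≠ w j) : ¬ ∀ j ≤ d, G.Adj v (w j) ↔ j = a ∨ j = a + 2 := by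
  intro hv
  have hne := hvw (a + 1) (by omega)
  have hnadj : ¬ G.Adj v (w (a + 1)) := by
    rw [hv _ (by omega)]
    omega
  refine hF (hasInducedCopyG_twoTails (x := ![v, w (a + 1)]) (lo := a) (hi := a + 2) hG hw
    (by omega) (by omega) (by omega) ?_ ?_ _ ?_ ?_ ?_ ?_ ?_ ?_)
  · intro i j h
    fin_cases i <;> fin_cases j <;> simp_all [eq_comm]
  · intro i j hj hja
    fin_cases i
    · exact hvw j hj
    · exact fun h => by have := (hw.eq_iff (by omega) hj).mp h; omega
  · intro i j
    fin_cases i <;> fin_cases j <;> simp [F3G, hnadj, G.adj_comm _ v]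
  · intro i k
    fin_cases i
    · simp [F3G, hv _ (show a - k ≤ d by omega)]
      omega
    · simp [F3G, hw.adj_iff hG (show a + 1 ≤ d by omega) (show a - k ≤ d by omega)]
      omega
  · intro i k
    fin_cases i
    · simp [F3G, hv _ (show a + 2 + k ≤ d by omega)]
      omega
    · simp [F3G, hw.adj_iff hG (show a + 1 ≤ d by omega) (show a + 2 + k ≤ d by omega)]
      omega
  · intro k l
    simp [F3G]
    omega
  · intro k l
    simp [F3G]
    omega
  · intro k l
    simp [F3G]

/-- Two vertices joined to exactly the same two consecutive vertices in the middle of a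
geodesic are adjacent. -/
theorem adj_of_triangles (hG : G.Connected) (hF : ¬ HasInducedCopyG (F4G n) G)
    (hw : IsGeodesic G r w d) {a : ℕ} (ha : n ≤ a) (had : a + n + 1 ≤ d) {u v : V}
    (hvw : ∀ j ≤ d, v ≠ w j) (hv : ∀ j ≤ d, G.Adj v (w j) ↔ j = a ∨ j = a + 1)
    (huw : ∀ j ≤ d, u ≠ w j) (hu : ∀ j ≤ d, G.Adj u (w j) ↔ j = a ∨ j = a + 1)
    (hne : v ≠ u) : G.Adj v u := by
  by_contra hnadj
  refine hF (hasInducedCopyG_twoTails (x := ![v, u]) (lo := a) (hi := a + 1) hG hw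
    (by omega) (by omega) (by omega) ?_ ?_ _ ?_ ?_ ?_ ?_ ?_ ?_)
  · intro i j h
    fin_cases i <;> fin_cases j <;> simp_all
  · intro i j hj hja
    fin_cases i
    · exact hvw j hj
    · exact huw j hj
  · intro i j
    fin_cases i <;> fin_cases j <;> simp [F4G, F3G, YZEdgeG, hnadj, G.adj_comm u v]
  · intro i k
    fin_cases i
    · simp [F4G, F3G, YZEdgeG, hv _ (show a - k ≤ d by omega)]
      omega
    · simp [F4G, F3G, YZEdgeG, hu _ (show a - k ≤ d by omega)]
      omega
  · intro i k
    fin_cases i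
    · simp [F4G, F3G, YZEdgeG, hv _ (show a + 1 + k ≤ d by omega)]
      omega
    · simp [F4G, F3G, YZEdgeG, hu _ (show a + 1 + k ≤ d by omega)]
      omega
  · intro k l
    simp [F4G, F3G, YZEdgeG]
    omega
  · intro k l
    simp [F4G, F3G, YZEdgeG]
    omega
  · intro k l
    simp [F4G, F3G, YZEdgeG]

/-- If `v` is joined to exactly two consecutive vertices in the middle of a directed geodesic,
then it can be inserted between them. -/
theorem arcs_of_triangle {E : V → V → Prop} (hG : G.Connected)
    (hGE : ∀ u v, G.Adj u v ↔ E u v ∨ E v u) (hE : ∀ u v, E u v → ¬ E v u) (hD : CondD2 n E)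
    (hw : IsGeodesic G r w d) {a : ℕ} (ha : n ≤ a) (had : a + n + 1 ≤ d)
    (hdir : ∀ j, a ≤ j + n → j ≤ a + n → E (w j) (w (j + 1))) {v : V}
    (hvw : ∀ j ≤ d, v ≠ w j) (hv : ∀ j ≤ d, G.Adj v (w j) ↔ j = a ∨ j = a + 1) :
    E (w a) v ∧ E v (w (a + 1)) := by
  obtain ⟨hD1, hD2, hD3⟩ := hD
  have hva := (hGE _ _).mp ((hv a (by omega)).mpr (Or.inl rfl))
  have hva' := (hGE _ _).mp ((hv (a + 1) (by omega)).mpr (Or.inr rfl))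
  have hoff : ∀ j ≤ d, j ≠ a → j ≠ a + 1 → ¬ E v (w j) ∧ ¬ E (w j) v := by
    intro j hj h₁ h₂
    have := (hGE v (w j)).not.mp (by rw [hv j hj]; omega)
    tauto
  have harc : ∀ i j, a ≤ i + n → a ≤ j + n → i ≤ a + 1 + n → j ≤ a + 1 + n → i ≤ d → j ≤ d →
      (E (w i) (w j) ↔ i + 1 = j) := by
    intro i j hi hj hi' hj' hid hjd
    constructor
    · intro h
      rcases (hw.adj_iff hG hid hjd).mp ((hGE _ _).mpr (Or.inl h)) with h' | rfl
      · exact h'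
      · exact absurd (hdir j (by omega) (by omega)) (hE _ _ h)
    · rintro rfl
      exact hdir i (by omega) (by omega)
  have hinj : Function.Injective (twoTails (fun _ : Unit => v) w a (a + 1) n) :=
    twoTails_injective hw (by omega) (by omega) (by omega) (fun _ _ _ => rfl)
      fun _ j hj _ => hvw j hj
  have hvv : ¬ E v v := fun h => hE v v h h
  have hcopy : ∀ H : Unit ⊕ Fin n ⊕ Fin n → Unit ⊕ Fin n ⊕ Fin n → Prop,
      ¬ DigraphHasInducedCopy H E → ¬ H (.inl ()) (.inl ()) →
      (∀ k : Fin n, H (.inl ()) (.inr (.inl k)) ↔ k.val = 0 ∧ E v (w a)) →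
      (∀ k : Fin n, H (.inr (.inl k)) (.inl ()) ↔ k.val = 0 ∧ E (w a) v) →
      (∀ k : Fin n, H (.inl ()) (.inr (.inr k)) ↔ k.val = 0 ∧ E v (w (a + 1))) →
      (∀ k : Fin n, H (.inr (.inr k)) (.inl ()) ↔ k.val = 0 ∧ E (w (a + 1)) v) →
      (∀ k l : Fin n, H (.inr (.inl k)) (.inr (.inl l)) ↔ l.val + 1 = k.val) →
      (∀ k l : Fin n, H (.inr (.inr k)) (.inr (.inr l)) ↔ k.val + 1 = l.val) →
      (∀ k l : Fin n, H (.inr (.inl k)) (.inr (.inr l)) ↔ k.val = 0 ∧ l.val = 0) →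
      (∀ k l : Fin n, ¬ H (.inr (.inr k)) (.inr (.inl l))) → False := by
    intro H hH hxx hxy hyx hxz hzx hyy hzz hyz hzy
    refine hH ⟨_, hinj, ?_⟩
    rintro (i | i | i) (j | j | j) <;> simp only [twoTails, Sum.elim_inl, Sum.elim_inr]
    · exact iff_of_false hvv hxx
    · rw [hxy]
      rcases Nat.eq_zero_or_pos j.val with h | h
      · simp [h]
      · exact iff_of_false (hoff _ (by omega) (by omega) (by omega)).1 (by omega)
    · rw [hxz]
      rcases Nat.eq_zero_or_pos j.val with h | h
      · simp [h]
      · exact iff_of_false (hoff _ (by omega) (by omega) (by omega)).1 (by omega)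
    · rw [hyx]
      rcases Nat.eq_zero_or_pos i.val with h | h
      · simp [h]
      · exact iff_of_false (hoff _ (by omega) (by omega) (by omega)).2 (by omega)
    · rw [hyy, harc _ _ (by omega) (by omega) (by omega) (by omega) (by omega) (by omega)]
      omega
    · rw [hyz, harc _ _ (by omega) (by omega) (by omega) (by omega) (by omega) (by omega)]
      omega
    · rw [hzx]
      rcases Nat.eq_zero_or_pos i.val with h | h
      · simp [h]
      · exact iff_of_false (hoff _ (by omega) (by omega) (by omega)).2 (by omega)
    · refine iff_of_false ?_ (hzy i j)
      rw [harc _ _ (by omega) (by omega) (by omega) (by omega) (by omega) (by omega)]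
      omega
    · rw [hzz, harc _ _ (by omega) (by omega) (by omega) (by omega) (by omega) (by omega)]
      omega
  rcases hva with h₁ | h₁ <;> rcases hva' with h₂ | h₂
  · exact (hcopy _ hD2 (by simp [D2Rel]) (by simp [D2Rel, h₁]) (by simp [D2Rel, hE _ _ h₁])
      (by simp [D2Rel, h₂]) (by simp [D2Rel, hE _ _ h₂]) (by simp [D2Rel]) (by simp [D2Rel])
      (by simp [D2Rel]) (by simp [D2Rel])).elim
  · exact (hcopy _ hD1 (by simp [D1Rel]) (by simp [D1Rel, h₁]) (by simp [D1Rel, hE _ _ h₁])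
      (by simp [D1Rel, hE _ _ h₂]) (by simp [D1Rel, h₂]) (by simp [D1Rel]) (by simp [D1Rel])
      (by simp [D1Rel]) (by simp [D1Rel])).elim
  · exact ⟨h₁, h₂⟩
  · exact (hcopy _ hD3 (by simp [D3Rel]) (by simp [D3Rel, hE _ _ h₁]) (by simp [D3Rel, h₁])
      (by simp [D3Rel, hE _ _ h₂]) (by simp [D3Rel, h₂]) (by simp [D3Rel]) (by simp [D3Rel])
      (by simp [D3Rel]) (by simp [D3Rel])).elim

end Forbidden

/-! ## Neighbourhoods of geodesics -/

/-- The underlying graph conditions that control the neighbourhood of a geodesic. -/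
structure TailFree {V : Type} (n : ℕ) (G : SimpleGraph V) : Prop where
  f1 : ¬ HasInducedCopyG (F1G n) G
  f2 : ¬ HasInducedCopyG (F2G n) G
  f3 : ¬ HasInducedCopyG (F3G n) G
  f4 : ¬ HasInducedCopyG (F4G n) G

/-- `v` equals or is joined to the vertex of `w` on its level. -/
def Near {V : Type} (G : SimpleGraph V) (r : V) (w : ℕ → V) (v : V) : Prop :=
  v = w (G.dist r v) ∨ G.Adj v (w (G.dist r v))

section Local

variable {V : Type} {G : SimpleGraph V} {r : V} {w : ℕ → V} {d n : ℕ}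

theorem level_eq_of_adj (hG : G.Connected) (hw : IsGeodesic G r w d) {m j : ℕ} {v : V}
    (hv : G.dist r v = m + 1) (hj : j ≤ d) (h : G.Adj v (w j)) :
    j = m ∨ j = m + 1 ∨ j = m + 2 := by
  have := hG.dist_le_of_adj r h
  rw [hw.dist_eq j hj] at this
  omega

theorem adj_level_of_adj (hG : G.Connected) (hF : TailFree n G) (hn : 0 < n)
    (hw : IsGeodesic G r w d) {m : ℕ} {v : V} (hv : G.dist r v = m + 1) (hm : n ≤ m)
    (hmd : m + n + 2 ≤ d) (hne : v ≠ w (m + 1)) (hatt : ∃ j ≤ d, G.Adj v (w j)) :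
    G.Adj v (w (m + 1)) ∧ (G.Adj v (w m) ∨ G.Adj v (w (m + 2))) := by
  have hvw : ∀ j ≤ d, v ≠ w j := fun j hj => hw.ne_of_dist (by rwa [hv]) hj
  have hiff : ∀ j ≤ d, G.Adj v (w j) ↔ (j = m ∧ G.Adj v (w m)) ∨
      (j = m + 1 ∧ G.Adj v (w (m + 1))) ∨ (j = m + 2 ∧ G.Adj v (w (m + 2))) := by
    intro j hj
    constructor
    · intro h
      rcases level_eq_of_adj hG hw hv hj h with rfl | rfl | rfl <;> simp [h]
    · rintro (⟨rfl, h⟩ | ⟨rfl, h⟩ | ⟨rfl, h⟩) <;> exact h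
  have h₁ := not_forall_adj_iff_eq hG hF.f1 hn hw (a := m) (by omega) (by omega) hvw
  have h₂ := not_forall_adj_iff_eq hG hF.f1 hn hw (a := m + 1) (by omega) (by omega) hvw
  have h₃ := not_forall_adj_iff_eq hG hF.f1 hn hw (a := m + 2) (by omega) (by omega) hvw
  have h₄ := not_forall_adj_iff_or_add_two hG hF.f3 hw (a := m) (by omega) (by omega) hvw
  have h₅ : ¬ ∀ j ≤ d, G.Adj v (w j) ↔ False := fun h =>
    hatt.elim fun j hj => (h j hj.1).mp hj.2
  by_cases hA : G.Adj v (w m) <;> by_cases hB : G.Adj v (w (m + 1)) <;>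
    by_cases hC : G.Adj v (w (m + 2)) <;> simp only [hA, hB, hC, and_true, and_false, or_false,
      false_or] at hiff ⊢
  all_goals first
    | exact absurd hiff h₁
    | exact absurd hiff h₂
    | exact absurd hiff h₃
    | exact absurd hiff h₄
    | exact absurd hiff h₅
    | simp

theorem near_of_exists_adj (hG : G.Connected) (hF : TailFree n G) (hn : 0 < n)
    (hw : IsGeodesic G r w d) {v : V} (hm : n + 1 ≤ G.dist r v)
    (hmd : G.dist r v + n + 1 ≤ d) (hatt : ∃ j ≤ d, v = w j ∨ G.Adj v (w j)) :
    Near G r w v := by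
  by_cases hne : v = w (G.dist r v)
  · exact Or.inl hne
  obtain ⟨m, hl⟩ : ∃ m, G.dist r v = m + 1 := ⟨G.dist r v - 1, by omega⟩
  right
  rw [hl] at hne hm hmd ⊢
  refine (adj_level_of_adj hG hF hn hw hl (by omega) (by omega) hne ?_).1
  obtain ⟨j, hj, rfl | h⟩ := hatt
  · rw [hw.dist_eq j hj] at hl
    exact absurd (by rw [hl]) hne
  · exact ⟨j, hj, h⟩

/-- In the middle of a geodesic, the set of vertices near the geodesic is closed under
taking neighbours. -/
theorem Near.of_adj (hG : G.Connected) (hF : TailFree n G) (hn : 0 < n)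
    (hw : IsGeodesic G r w d) {u v : V} (hv : Near G r w v) (hm : n + 2 ≤ G.dist r v)
    (hmd : G.dist r v + n + 2 ≤ d) (huv : G.Adj v u) : Near G r w u := by
  have hlev := hG.dist_le_of_adj r huv
  refine near_of_exists_adj hG hF hn hw (by omega) (by omega) ?_
  by_contra! hu
  have huw : ∀ j ≤ d, u ≠ w j := fun j hj => (hu j hj).1
  by_cases hvl : v = w (G.dist r v)
  · exact (hu _ (by omega)).2 (hvl ▸ huv.symm)
  have hadj := hv.resolve_left hvl
  obtain ⟨m, hl⟩ : ∃ m, G.dist r v = m + 1 := ⟨G.dist r v - 1, by omega⟩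
  have hvw : ∀ j ≤ d, v ≠ w j := fun j hj => hw.ne_of_dist hvl hj
  rw [hl] at hm hmd hvl hadj
  have hside := (adj_level_of_adj hG hF hn hw hl (by omega) (by omega) hvl
    ⟨m + 1, by omega, hadj⟩).2
  by_cases h₀ : G.Adj v (w m)
  · by_cases h₂ : G.Adj v (w (m + 2))
    · have hw' := hw.update (by omega) hl h₀ h₂
      refine not_forall_adj_iff_eq hG hF.f1 hn hw' (a := m + 1) (v := u) (by omega) (by omega)
        ?_ ?_
      · intro j hj
        rcases eq_or_ne j (m + 1) with rfl | h
        · simpa using huv.ne'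
        · simpa [h] using huw j hj
      · intro j hj
        rcases eq_or_ne j (m + 1) with rfl | h
        · simpa using huv.symm
        · simpa [h] using (hu j hj).2
    · obtain ⟨j, hj, h⟩ := exists_adj_of_adj_of_triangle hG hF.f2 hw (a := m) (by omega) (by omega)
        hvw (fun j hj => ⟨fun h => by
          rcases level_eq_of_adj hG hw hl hj h with rfl | rfl | rfl
          · exact Or.inl rfl
          · exact Or.inr rfl
          · exact absurd h h₂, by rintro (rfl | rfl) <;> assumption⟩) huw huv
      exact (hu j hj).2 h
  · have h₂ := hside.resolve_left h₀
    obtain ⟨j, hj, h⟩ := exists_adj_of_adj_of_triangle hG hF.f2 hw (a := m + 1) (by omega)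
      (by omega) hvw (fun j hj => ⟨fun h => by
        rcases level_eq_of_adj hG hw hl hj h with rfl | rfl | rfl
        · exact absurd h h₀
        · exact Or.inl rfl
        · exact Or.inr rfl, by rintro (rfl | rfl) <;> assumption⟩) huw huv
    exact (hu j hj).2 h

end Local

/-! ## Directed stretches of a geodesic -/

/-- Between the indices `lo` and `hi`, the geodesic `w` is directed forwards, and so is
every geodesic obtained by replacing one of its inner vertices. -/
structure IsStableStretch {V : Type} (G : SimpleGraph V) (r : V) (E : V → V → Prop) (w : ℕ → V)
    (lo hi : ℕ) : Prop where
  dir : ∀ j, lo ≤ j → j < hi → E (w j) (w (j + 1))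
  stable : ∀ m v, lo ≤ m → m + 2 ≤ hi → G.dist r v = m + 1 → G.Adj v (w m) →
    G.Adj v (w (m + 2)) → E (w m) v ∧ E v (w (m + 2))

/-- The vertices that can be inserted between `w i` and `w (i + 1)`. -/
def insertable {V : Type} (E : V → V → Prop) (w : ℕ → V) (i : ℕ) : Set V :=
  {v | E (w i) v ∧ E v (w (i + 1))}

section Stretch

variable {V : Type} {G : SimpleGraph V} {r : V} {E : V → V → Prop} {w : ℕ → V} {d n lo hi : ℕ}

theorem exists_mem_insertable (hG : G.Connected) (hF : TailFree n G) (hn : 0 < n)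
    (hGE : ∀ u v, G.Adj u v ↔ E u v ∨ E v u) (hE : ∀ u v, E u v → ¬ E v u) (hD : CondD2 n E)
    (hw : IsGeodesic G r w d) (hS : IsStableStretch G r E w lo hi) (hhi : hi ≤ d) {m : ℕ} {v : V}
    (hv : G.dist r v = m + 1) (hm : lo + n ≤ m) (hmd : m + n + 2 ≤ hi) (hnear : Near G r w v)
    (hne : v ≠ w (m + 1)) : v ∈ insertable E w m ∨ v ∈ insertable E w (m + 1) := by
  rw [Near, hv] at hnear
  have hadj := hnear.resolve_left hne
  have hvw : ∀ j ≤ d, v ≠ w j := fun j hj => hw.ne_of_dist (by rwa [hv]) hj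
  have hside := (adj_level_of_adj hG hF hn hw hv (by omega) (by omega) hne
    ⟨m + 1, by omega, hadj⟩).2
  by_cases h₀ : G.Adj v (w m)
  · by_cases h₂ : G.Adj v (w (m + 2))
    · obtain ⟨h₃, h₄⟩ := hS.stable m v (by omega) (by omega) hv h₀ h₂
      rcases (hGE _ _).mp hadj with h | h
      · exact Or.inl ⟨h₃, h⟩
      · exact Or.inr ⟨h, h₄⟩
    · exact Or.inl (arcs_of_triangle hG hGE hE hD hw (a := m) (by omega) (by omega)
        (fun j h₁ h₂ => hS.dir j (by omega) (by omega)) hvw (fun j hj => ⟨fun h => by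
          rcases level_eq_of_adj hG hw hv hj h with rfl | rfl | rfl
          · exact Or.inl rfl
          · exact Or.inr rfl
          · exact absurd h h₂, by rintro (rfl | rfl) <;> assumption⟩))
  · have h₂ := hside.resolve_left h₀
    exact Or.inr (arcs_of_triangle hG hGE hE hD hw (a := m + 1) (by omega) (by omega)
        (fun j h₁ h₂ => hS.dir j (by omega) (by omega)) hvw (fun j hj => ⟨fun h => by
        rcases level_eq_of_adj hG hw hv hj h with rfl | rfl | rfl
        · exact absurd h h₀
        · exact Or.inl rfl
        · exact Or.inr rfl, by rintro (rfl | rfl) <;> assumption⟩))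

theorem adj_of_mem_insertable (hGE : ∀ u v, G.Adj u v ↔ E u v ∨ E v u) {i : ℕ} {v : V}
    (hv : v ∈ insertable E w i) : G.Adj v (w i) ∧ G.Adj v (w (i + 1)) :=
  ⟨(hGE _ _).mpr (Or.inr hv.1), (hGE _ _).mpr (Or.inl hv.2)⟩

theorem level_of_mem_insertable (hG : G.Connected) (hGE : ∀ u v, G.Adj u v ↔ E u v ∨ E v u)
    (hw : IsGeodesic G r w d) {i : ℕ} (hi : i + 1 ≤ d) {v : V} (hv : v ∈ insertable E w i) :
    G.dist r v = i ∨ G.dist r v = i + 1 := by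
  obtain ⟨h₁, h₂⟩ := adj_of_mem_insertable hGE hv
  have h₁ := hG.dist_le_of_adj r h₁
  have h₂ := hG.dist_le_of_adj r h₂
  rw [hw.dist_eq _ (by omega)] at h₁ h₂
  omega

theorem ne_of_mem_insertable (hG : G.Connected) (hGE : ∀ u v, G.Adj u v ↔ E u v ∨ E v u)
    (hw : IsGeodesic G r w d) {i : ℕ} (hi : i + 1 ≤ d) {v : V} (hv : v ∈ insertable E w i)
    {j : ℕ} (hj : j ≤ d) : v ≠ w j := by
  rintro rfl
  obtain ⟨h₁, h₂⟩ := adj_of_mem_insertable hGE hv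
  rw [hw.adj_iff hG (by omega) (by omega)] at h₁ h₂
  omega

theorem near_of_mem_insertable (hG : G.Connected) (hGE : ∀ u v, G.Adj u v ↔ E u v ∨ E v u)
    (hw : IsGeodesic G r w d) {i : ℕ} (hi : i + 1 ≤ d) {v : V} (hv : v ∈ insertable E w i) :
    Near G r w v := by
  obtain ⟨h₁, h₂⟩ := adj_of_mem_insertable hGE hv
  rcases level_of_mem_insertable hG hGE hw hi hv with h | h <;>
    exact Or.inr (by rwa [h])

theorem insertable_unique (hG : G.Connected) (hGE : ∀ u v, G.Adj u v ↔ E u v ∨ E v u)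
    (hE : ∀ u v, E u v → ¬ E v u) (hw : IsGeodesic G r w d) {i j : ℕ} (hij : i < j)
    (hj : j + 1 ≤ d) {v : V} (hv : v ∈ insertable E w i) : v ∉ insertable E w j := by
  intro hv'
  have h₁ := hG.dist_le_of_adj r (adj_of_mem_insertable hGE hv).1
  have h₂ := hG.dist_le_of_adj r (adj_of_mem_insertable hGE hv').2
  rw [hw.dist_eq _ (by omega)] at h₁ h₂
  obtain rfl : j = i + 1 := by omega
  exact hE _ _ hv.2 hv'.1

/-- The vertices insertable at a given place induce a tournament. -/
theorem adj_of_mem_insertable_of_mem_insertable (hG : G.Connected) (hF : TailFree n G)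
    (hn : 0 < n) (hGE : ∀ u v, G.Adj u v ↔ E u v ∨ E v u) (hE : ∀ u v, E u v → ¬ E v u)
    (hD : CondD2 n E) (hw : IsGeodesic G r w d) (hS : IsStableStretch G r E w lo hi)
    (hhi : hi ≤ d) {i : ℕ} (hi₁ : lo + n + 1 ≤ i) (hi₂ : i + n + 3 ≤ hi) {u v : V}
    (hu : u ∈ insertable E w i) (hv : v ∈ insertable E w i) (huv : u ≠ v) : G.Adj u v := by
  by_contra hnadj
  obtain ⟨k, rfl⟩ : ∃ k, i = k + 1 := ⟨i - 1, by omega⟩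
  -- the vertices `u` and `v` have no neighbour before `w i`
  have hbefore : ∀ u ∈ insertable E w (k + 1), ∀ v ∈ insertable E w (k + 1), u ≠ v →
      ¬ G.Adj u v → ¬ G.Adj u (w k) := by
    intro u hu v hv huv hnadj huk
    have hua := adj_of_mem_insertable hGE hu
    have hva := adj_of_mem_insertable hGE hv
    have hlu : G.dist r u = k + 1 := by
      have h₁ := hG.dist_le_of_adj r huk
      have h₂ := hG.dist_le_of_adj r hua.2
      rw [hw.dist_eq _ (by omega)] at h₁ h₂
      omega
    have hw' := hw.update (by omega) hlu huk hua.2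
    have hvw' : ∀ j ≤ d, v ≠ Function.update w (k + 1) u j := by
      intro j hj
      rcases eq_or_ne j (k + 1) with rfl | h
      · simpa using huv.symm
      · simpa [h] using ne_of_mem_insertable hG hGE hw (by omega) hv hj
    have hatt : ∃ j ≤ d, G.Adj v (Function.update w (k + 1) u j) :=
      ⟨k + 2, by omega, by simpa using hva.2⟩
    rcases level_of_mem_insertable hG hGE hw (by omega) hv with hlv | hlv
    · have := (adj_level_of_adj hG hF hn hw' hlv (by omega) (by omega) (hvw' _ (by omega)) hatt).1
      rw [Function.update_self] at this
      exact hnadj this.symm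
    · have hlv : G.dist r v = (k + 1) + 1 := hlv
      have h := (adj_level_of_adj hG hF hn hw' hlv (by omega) (by omega) (hvw' _ (by omega))
        hatt).2
      rw [Function.update_self] at h
      have h := h.resolve_left fun h => hnadj h.symm
      obtain ⟨hE₁, hE₂⟩ := hS.stable k u (by omega) (by omega) hlu huk hua.2
      have := (arcs_of_triangle hG hGE hE hD hw' (a := k + 2) (by omega) (by omega) ?_ hvw'
        fun j hj => ⟨fun h' => ?_, ?_⟩).1
      · simp only [Function.update_of_ne (show k + 2 ≠ k + 1 by omega)] at this
        exact hE _ _ this hv.2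
      · intro j hj₁ hj₂
        rcases eq_or_ne j (k + 1) with rfl | h₁
        · simpa using hE₂
        · rcases eq_or_ne j k with rfl | h₂
          · simpa using hE₁
          · simpa [h₁, h₂] using hS.dir j (by omega) (by omega)
      · rcases level_eq_of_adj hG hw' hlv hj h' with rfl | rfl | rfl
        · rw [Function.update_self] at h'
          exact absurd h'.symm hnadj
        · exact Or.inl rfl
        · exact Or.inr rfl
      · rintro (rfl | rfl)
        · simpa using hva.2
        · exact h
  have hafter : ∀ u ∈ insertable E w (k + 1), ∀ v ∈ insertable E w (k + 1), u ≠ v →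
      ¬ G.Adj u v → ¬ G.Adj u (w (k + 3)) := by
    intro u hu v hv huv hnadj huk
    have hua := adj_of_mem_insertable hGE hu
    have hva := adj_of_mem_insertable hGE hv
    have hlu : G.dist r u = (k + 1) + 1 := by
      have h₁ := hG.dist_le_of_adj r huk
      have h₂ := hG.dist_le_of_adj r hua.1
      rw [hw.dist_eq _ (by omega)] at h₁ h₂
      omega
    have hw' := hw.update (by omega) hlu hua.1 huk
    have hvw' : ∀ j ≤ d, v ≠ Function.update w (k + 1 + 1) u j := by
      intro j hj
      rcases eq_or_ne j (k + 1 + 1) with rfl | h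
      · simpa using huv.symm
      · simpa [h] using ne_of_mem_insertable hG hGE hw (by omega) hv hj
    have hatt : ∃ j ≤ d, G.Adj v (Function.update w (k + 1 + 1) u j) :=
      ⟨k + 1, by omega, by simpa using hva.1⟩
    rcases level_of_mem_insertable hG hGE hw (by omega) hv with hlv | hlv
    · have h := (adj_level_of_adj hG hF hn hw' hlv (by omega) (by omega) (hvw' _ (by omega))
        hatt).2
      rw [Function.update_self] at h
      have h := h.resolve_right fun h => hnadj h.symm
      rw [Function.update_of_ne (by omega)] at h
      exact hbefore v hv u hu huv.symm (fun h => hnadj h.symm) h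
    · have := (adj_level_of_adj hG hF hn hw' hlv (by omega) (by omega) (hvw' _ (by omega)) hatt).1
      rw [Function.update_self] at this
      exact hnadj this.symm
  have htri : ∀ u ∈ insertable E w (k + 1), ∀ v ∈ insertable E w (k + 1), u ≠ v →
      ¬ G.Adj u v → ∀ j ≤ d, G.Adj u (w j) ↔ j = k + 1 ∨ j = k + 1 + 1 := by
    intro u hu v hv huv hnadj j hj
    have hua := adj_of_mem_insertable hGE hu
    constructor
    · intro h
      have h₁ := hG.dist_le_of_adj r h
      rw [hw.dist_eq _ (by omega)] at h₁
      have h₂ : j ≠ k := fun hjk => hbefore u hu v hv huv hnadj (hjk ▸ h)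
      have h₃ : j ≠ k + 3 := fun hjk => hafter u hu v hv huv hnadj (hjk ▸ h)
      rcases level_of_mem_insertable hG hGE hw (by omega) hu with h₄ | h₄ <;> omega
    · rintro (rfl | rfl)
      · exact hua.1
      · exact hua.2
  exact hnadj (adj_of_triangles hG hF.f4 hw (a := k + 1) (by omega) (by omega)
    (fun j hj => ne_of_mem_insertable hG hGE hw (by omega) hu hj) (htri u hu v hv huv hnadj)
    (fun j hj => ne_of_mem_insertable hG hGE hw (by omega) hv hj)
    (htri v hv u hu huv.symm fun h => hnadj h.symm) huv)

/-- The neighbourhood of a directed stretch of a geodesic has a Hamiltonian directed path. -/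
theorem exists_list_stretch [Fintype V] (hG : G.Connected) (hF : TailFree n G)
    (hn : 0 < n) (hGE : ∀ u v, G.Adj u v ↔ E u v ∨ E v u) (hE : ∀ u v, E u v → ¬ E v u)
    (hD : CondD2 n E) (hw : IsGeodesic G r w d) (hS : IsStableStretch G r E w lo hi)
    (hhi : hi ≤ d) {a b : ℕ} (hab : a ≤ b) (ha : lo + n + 1 ≤ a) (hb : b + n + 2 ≤ hi) :
    ∃ l : List V, l.Nodup ∧ l.IsChain E ∧ (∀ x ∈ l.getLast?, E x (w b)) ∧
      ∀ v, v ∈ l ↔ ∃ i, a ≤ i ∧ i < b ∧ (v = w i ∨ v ∈ insertable E w i) := by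
  induction b, hab using Nat.le_induction with
  | base => exact ⟨[], by simp, by simp, by simp, by grind⟩
  | succ b hab ih =>
    obtain ⟨l, hnd, hch, hlast, hmem⟩ := ih (by omega)
    obtain ⟨t, htnd, htch, htmem⟩ := exists_hamiltonian_list (E := E) (X := insertable E w b)
      fun u hu v hv huv => (hGE u v).mp (adj_of_mem_insertable_of_mem_insertable hG hF hn hGE hE
        hD hw hS hhi (by omega) (by omega) hu hv huv)
    have hbt : w b ∉ t := fun h =>
      ne_of_mem_insertable hG hGE hw (by omega) ((htmem _).mp h) (j := b) (by omega) rfl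
    refine ⟨l ++ w b :: t, ?_, ?_, ?_, ?_⟩
    · rw [List.nodup_append]
      refine ⟨hnd, List.nodup_cons.mpr ⟨hbt, htnd⟩, ?_⟩
      rintro x hx y hy rfl
      obtain ⟨i, hai, hib, hxi⟩ := (hmem x).mp hx
      rcases List.mem_cons.mp hy with hy | hy
      · rcases hxi with h | h
        · have := (hw.eq_iff (by omega) (by omega)).mp (h.symm.trans hy)
          omega
        · exact ne_of_mem_insertable hG hGE hw (by omega) h (j := b) (by omega) hy
      · rw [htmem] at hy
        rcases hxi with h | h
        · exact ne_of_mem_insertable hG hGE hw (by omega) hy (j := i) (by omega) h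
        · exact insertable_unique hG hGE hE hw hib (by omega) h hy
    · rw [List.isChain_append]
      refine ⟨hch, ?_, by simpa using hlast⟩
      rw [List.isChain_cons]
      exact ⟨fun y hy => ((htmem y).mp (List.mem_of_mem_head? hy)).1, htch⟩
    · intro x hx
      rw [List.getLast?_append_cons] at hx
      rcases List.mem_cons.mp (List.mem_of_getLast? hx) with rfl | h
      · exact hS.dir b (by omega) (by omega)
      · exact ((htmem x).mp h).2
    · intro v
      rw [List.mem_append, List.mem_cons, hmem, htmem]
      constructor
      · rintro (⟨i, h₁, h₂, h₃⟩ | h)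
        · exact ⟨i, h₁, by omega, h₃⟩
        · exact ⟨b, hab, by omega, h⟩
      · rintro ⟨i, h₁, h₂, h₃⟩
        rcases Nat.lt_or_ge i b with h | h
        · exact Or.inl ⟨i, h₁, h, h₃⟩
        · obtain rfl : i = b := by omega
          exact Or.inr h₃

end Stretch

/-! ## Turns of a geodesic -/

/-- The vertex `w (i + 1)` has in-degree two or out-degree two on `w`. -/
def Turn {V : Type} (E : V → V → Prop) (w : ℕ → V) (i : ℕ) : Prop :=
  (E (w (i + 1)) (w i) ∧ E (w (i + 1)) (w (i + 2))) ∨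
    (E (w i) (w (i + 1)) ∧ E (w (i + 2)) (w (i + 1)))

open Classical in
/-- The indices `i` such that `w (i + 1)` is a turn of `w 0, …, w d`. -/
noncomputable def turns {V : Type} (E : V → V → Prop) (w : ℕ → V) (d : ℕ) : Finset ℕ :=
  (Finset.range d).filter fun i => i + 2 ≤ d ∧ Turn E w i

section Turns

variable {V : Type} {G : SimpleGraph V} {r : V} {E : V → V → Prop} {w : ℕ → V} {d n : ℕ}

theorem mem_turns {i : ℕ} : i ∈ turns E w d ↔ i + 2 ≤ d ∧ Turn E w i := by
  simp only [turns, Finset.mem_filter, Finset.mem_range]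
  exact ⟨fun h => h.2, fun h => ⟨by omega, h⟩⟩

theorem turn_flip {i : ℕ} : Turn (flip E) w i ↔ Turn E w i := Or.comm

theorem turns_flip : turns (flip E) w d = turns E w d := by
  ext i
  rw [mem_turns, mem_turns, turn_flip]

theorem card_turns_le (hG : G.Connected) (hGE : ∀ u v, G.Adj u v ↔ E u v ∨ E v u)
    (hD : CondD3 n E) (hw : IsGeodesic G r w d) : (turns E w d).card ≤ n := by
  classical
  refine le_trans ?_ (hD (d + 1) (fun i => w i) ⟨fun i j h => Fin.ext
    ((hw.eq_iff (by omega) (by omega)).mp h), fun i j => by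
      rw [← hGE, hw.adj_iff hG (by omega) (by omega)]⟩)
  rw [turnCount, Set.ncard_eq_toFinset_card']
  refine Finset.card_le_card_of_injOn (fun i => Fin.ofNat (d + 1) (i + 1)) (fun i hi => ?_)
    fun i hi j hj h => ?_
  · obtain ⟨hid, hi⟩ := mem_turns.mp hi
    have hval : (Fin.ofNat (d + 1) (i + 1)).val = i + 1 := Nat.mod_eq_of_lt (by omega)
    simp only [Set.coe_toFinset, Set.mem_ofPred_eq]
    refine ⟨⟨i, by omega⟩, ⟨i + 2, by omega⟩, by simp only [hval], by simp only [hval], ?_⟩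
    simpa only [hval, Turn] using hi
  · have hi := (mem_turns.mp hi).1
    have hj := (mem_turns.mp hj).1
    have := congrArg Fin.val h
    simp only [Fin.ofNat, Nat.mod_eq_of_lt (show i + 1 < d + 1 by omega),
      Nat.mod_eq_of_lt (show j + 1 < d + 1 by omega)] at this
    omega

theorem IsGeodesic.isStableStretch (hGE : ∀ u v, G.Adj u v ↔ E u v ∨ E v u)
    (hw : IsGeodesic G r w d) {K lo hi : ℕ} (hK : K ≤ lo) (hhi : hi ≤ d)
    (hmax : ∀ w', IsGeodesic G r w' d → w' K = w K → (turns E w' d).card ≤ (turns E w d).card)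
    (hno : ∀ i, lo ≤ i → i + 2 ≤ hi → ¬ Turn E w i) (hdir : E (w lo) (w (lo + 1))) :
    IsStableStretch G r E w (lo + 1) (hi - 1) := by
  have hfwd : ∀ j, lo ≤ j → j < hi → E (w j) (w (j + 1)) := by
    intro j hj
    induction j, hj using Nat.le_induction with
    | base => exact fun _ => hdir
    | succ j hj ih =>
      intro hlt
      refine ((hGE _ _).mp (hw.adj (j + 1) (by omega))).resolve_right fun h => ?_
      exact hno j hj (by omega) (Or.inr ⟨ih (by omega), h⟩)
  refine ⟨fun j h₁ h₂ => hfwd j (by omega) (by omega), fun m v hm hmd hv h₁ h₂ => ?_⟩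
  set w' := Function.update w (m + 1) v with hw'
  have hgeo : IsGeodesic G r w' d := hw.update (by omega) hv h₁ h₂
  have hself : w' (m + 1) = v := by simp [hw']
  have hother : ∀ j, j ≠ m + 1 → w' j = w j := fun j hj => by simp [hw', hj]
  have hsub : turns E w d ⊆ turns E w' d := by
    intro i hi'
    rw [mem_turns] at hi' ⊢
    have hout : ¬ (lo ≤ i ∧ i + 2 ≤ hi) := fun h => hno i h.1 h.2 hi'.2
    rw [Turn, hother i (by omega), hother (i + 1) (by omega), hother (i + 2) (by omega)]
    exact hi'
  have heq := Finset.eq_of_subset_of_card_le hsub (hmax w' hgeo (hother K (by omega)))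
  have hno' : ∀ i, lo ≤ i → i + 2 ≤ hi → ¬ Turn E w' i := by
    intro i h₁ h₂ h
    have : i ∈ turns E w d := heq ▸ mem_turns.mpr ⟨by omega, h⟩
    exact hno i h₁ h₂ (mem_turns.mp this).2
  constructor
  · obtain ⟨k, rfl⟩ : ∃ k, m = k + 1 := ⟨m - 1, by omega⟩
    refine ((hGE _ _).mp h₁).resolve_left fun h => hno' k (by omega) (by omega) (Or.inr ?_)
    rw [hself, hother _ (by omega), hother _ (by omega)]
    exact ⟨hfwd k (by omega) (by omega), h⟩
  · refine ((hGE _ _).mp h₂).resolve_right fun h => hno' (m + 1) (by omega) (by omega) (Or.inl ?_)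
    rw [hself, hother _ (by omega), hother _ (by omega)]
    exact ⟨h, hfwd (m + 2) (by omega) (by omega)⟩

/-- Exchanging the two paths of `D^(1)_n`, `D^(2)_n` and `D^(3)_n` and reversing all arcs. -/
theorem DigraphHasInducedCopy.of_flip {H H' : Unit ⊕ Fin n ⊕ Fin n → Unit ⊕ Fin n ⊕ Fin n → Prop}
    (hH : ∀ a b, H' a b ↔ H (Sum.map id Sum.swap b) (Sum.map id Sum.swap a))
    (h : DigraphHasInducedCopy H (flip E)) : DigraphHasInducedCopy H' E := by
  obtain ⟨f, hf, hE⟩ := h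
  refine ⟨f ∘ Sum.map id Sum.swap, hf.comp (Function.Injective.sumMap Function.injective_id
    Sum.swap_leftInverse.injective), fun a b => ?_⟩
  rw [hH, ← hE]
  rfl

theorem CondD2.flip (hD : CondD2 n E) : CondD2 n (flip E) := by
  refine ⟨fun h => hD.1 (h.of_flip ?_), fun h => hD.2.2 (h.of_flip ?_),
    fun h => hD.2.1 (h.of_flip ?_)⟩ <;>
  · rintro (_ | _ | _) (_ | _ | _) <;> simp [D1Rel, D2Rel, D3Rel, and_comm, eq_comm]

/-- The vertices near a directed stretch of a geodesic, except those near its ends, lie on a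
directed path consisting of vertices near the stretch. -/
theorem IsGeodesic.exists_list_of_forall_not_turn [Fintype V] (hG : G.Connected)
    (hF : TailFree n G) (hn : 0 < n) (hGE : ∀ u v, G.Adj u v ↔ E u v ∨ E v u)
    (hE : ∀ u v, E u v → ¬ E v u) (hD : CondD2 n E) (hw : IsGeodesic G r w d) {K lo hi : ℕ}
    (hK : K ≤ lo) (hhi : hi ≤ d)
    (hmax : ∀ w', IsGeodesic G r w' d → w' K = w K → (turns E w' d).card ≤ (turns E w d).card)
    (hno : ∀ i, lo ≤ i → i + 2 ≤ hi → ¬ Turn E w i) :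
    ∃ l : List V, l.Nodup ∧ l.IsChain E ∧
      (∀ v ∈ l, Near G r w v ∧ lo + n + 2 ≤ G.dist r v ∧ G.dist r v + n + 3 ≤ hi) ∧
      ∀ v, Near G r w v → lo + n + 3 ≤ G.dist r v → G.dist r v + n + 4 ≤ hi → v ∈ l := by
  rcases Nat.lt_or_ge hi (lo + 2 * n + 5) with hlt | hle
  · exact ⟨[], by simp, by simp, by simp, fun v _ _ _ => by omega⟩
  obtain ⟨b, rfl⟩ : ∃ b, hi = b + n + 3 := ⟨hi - n - 3, by omega⟩
  wlog hdir : E (w lo) (w (lo + 1)) generalizing E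
  · obtain ⟨l, hnd, hch, hl⟩ := this (E := _root_.flip E)
      (fun u v => (hGE u v).trans Or.comm) (fun u v h => hE v u h) hD.flip (by simpa only [turns_flip])
      
      (by simpa only [turn_flip]) (((hGE _ _).mp (hw.adj lo (by omega))).resolve_left hdir)
    exact ⟨l.reverse, by simpa, List.isChain_reverse.mpr hch, by simpa using hl⟩
  have hS := hw.isStableStretch hGE hK hhi hmax hno hdir
  obtain ⟨l, hnd, hch, -, hmem⟩ := exists_list_stretch hG hF hn hGE hE hD hw hS (by omega)
    (a := lo + n + 2) (b := b) (by omega) (by omega) (by omega)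
  refine ⟨l, hnd, hch, fun v hv => ?_, fun v hv h₁ h₂ => ?_⟩
  · obtain ⟨i, h₁, h₂, rfl | h⟩ := (hmem v).mp hv
    · rw [Near, hw.dist_eq i (by omega)]
      exact ⟨Or.inl rfl, by omega, by omega⟩
    · have := level_of_mem_insertable hG hGE hw (by omega) h
      exact ⟨near_of_mem_insertable hG hGE hw (by omega) h, by omega, by omega⟩
  · refine (hmem v).mpr ?_
    obtain ⟨m, hm⟩ : ∃ m, G.dist r v = m + 1 := ⟨G.dist r v - 1, by omega⟩
    by_cases hvw : v = w (m + 1)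
    · exact ⟨m + 1, by omega, by omega, Or.inl hvw⟩
    · rcases exists_mem_insertable hG hF hn hGE hE hD hw hS (by omega) hm (by omega) (by omega)
        hv hvw with h | h
      · exact ⟨m, by omega, by omega, Or.inr h⟩
      · exact ⟨m + 1, by omega, by omega, Or.inr h⟩

end Turns

/-! ## A system of geodesics -/

/-- A finite set contains an independent set dominating it, where every element is dominated by
one of at least the same height. -/
theorem exists_indepSet_dominating {V : Type} (G : SimpleGraph V) (h : V → ℕ) (L : Finset V) :
    ∃ I ⊆ L, G.IsIndepSet (I : Set V) ∧
      ∀ x ∈ L, ∃ y ∈ I, (x = y ∨ G.Adj x y) ∧ h x ≤ h y := by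
  classical
  induction L using Finset.strongInduction with
  | H L ih =>
    rcases L.eq_empty_or_nonempty with rfl | hL
    · exact ⟨∅, by simp⟩
    obtain ⟨y, hy, hmax⟩ := L.exists_max_image h hL
    obtain ⟨I, hIL, hI, hdom⟩ := ih (L.filter fun x => x ≠ y ∧ ¬ G.Adj x y)
      (Finset.filter_ssubset.mpr ⟨y, hy, by simp⟩)
    refine ⟨insert y I, Finset.insert_subset hy (hIL.trans (Finset.filter_subset _ _)), ?_, ?_⟩
    · rw [Finset.coe_insert]
      refine Set.Pairwise.insert hI fun x hx _ => ?_
      have := (Finset.mem_filter.mp (hIL hx)).2.2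
      exact ⟨fun h => this h.symm, this⟩
    · intro x hx
      by_cases hxy : x = y ∨ G.Adj x y
      · exact ⟨y, Finset.mem_insert_self _ _, hxy, hmax x hx⟩
      · rw [not_or] at hxy
        obtain ⟨z, hz, h⟩ := hdom x (Finset.mem_filter.mpr ⟨hx, hxy⟩)
        exact ⟨z, Finset.mem_insert_of_mem hz, h⟩

/-- Among the geodesics from `r` that agree with `w` at `K`, the geodesic `w` has maximum length
and, subject to this, the maximum number of turns. -/
structure IsBestGeodesic {V : Type} (G : SimpleGraph V) (r : V) (E : V → V → Prop) (K : ℕ)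
    (w : ℕ → V) (d : ℕ) : Prop extends IsGeodesic G r w d where
  le : K ≤ d
  length_le : ∀ w' d', IsGeodesic G r w' d' → K ≤ d' → w' K = w K → d' ≤ d
  card_turns_le : ∀ w', IsGeodesic G r w' d → w' K = w K →
    (turns E w' d).card ≤ (turns E w d).card

theorem exists_isBestGeodesic {V : Type} [Fintype V] {G : SimpleGraph V} (hG : G.Connected)
    (r : V) (E : V → V → Prop) {K : ℕ} {y : V} (hy : G.dist r y = K) :
    ∃ w d, IsBestGeodesic G r E K w d ∧ w K = y := by
  classical
  have hmax : ∀ (p : ℕ → Prop) (B : ℕ), (∃ k, p k) → (∀ k, p k → k ≤ B) →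
      ∃ k, p k ∧ ∀ k', p k' → k' ≤ k := fun p B h₁ h₂ =>
    ⟨sSup {k | p k}, Nat.sSup_mem h₁ ⟨B, h₂⟩, fun k hk => le_csSup ⟨B, h₂⟩ hk⟩
  obtain ⟨w₀, hw₀, hw₀y⟩ := IsGeodesic.exists_of_dist hG r K y hy
  obtain ⟨d, ⟨hKd, w₁, hw₁, hw₁y⟩, hd⟩ :=
    hmax (fun d => K ≤ d ∧ ∃ w, IsGeodesic G r w d ∧ w K = y) (Finset.univ.sup (G.dist r))
      ⟨K, le_rfl, w₀, hw₀, hw₀y⟩ (by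
        rintro d ⟨-, w, hw, -⟩
        rw [← hw.dist_eq d le_rfl]
        exact Finset.le_sup (f := G.dist r) (Finset.mem_univ (w d)))
  obtain ⟨c, ⟨w, hw, hwy, rfl⟩, hc⟩ :=
    hmax (fun c => ∃ w, IsGeodesic G r w d ∧ w K = y ∧ (turns E w d).card = c) d
      ⟨_, w₁, hw₁, hw₁y, rfl⟩ (by
        rintro c ⟨w, -, -, rfl⟩
        exact (Finset.card_filter_le _ _).trans (by simp))
  refine ⟨w, d, ⟨hw, hKd, fun w' d' h₁ h₂ h₃ => ?_, fun w' h₁ h₂ => ?_⟩, hwy⟩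
  · exact hd d' ⟨h₂, w', h₁, h₃.trans hwy⟩
  · exact hc _ ⟨w', h₁, h₂.trans hwy, rfl⟩

/-- The indices of the turns of a geodesic, together with its start. -/
noncomputable def cuts {V : Type} (E : V → V → Prop) (w : ℕ → V) (d : ℕ) : Finset ℕ :=
  insert 0 ((turns E w d).image (· + 1))

section System

variable {V : Type} {G : SimpleGraph V} {r : V} {E : V → V → Prop} {w w' : ℕ → V} {d d' n : ℕ}

theorem le_of_mem_cuts {s : ℕ} (hs : s ∈ cuts E w d) : s = 0 ∨ s < d := by
  simp only [cuts, Finset.mem_insert, Finset.mem_image, mem_turns] at hs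
  omega

theorem card_cuts_le (hG : G.Connected) (hGE : ∀ u v, G.Adj u v ↔ E u v ∨ E v u)
    (hD : CondD3 n E) (hw : IsGeodesic G r w d) : (cuts E w d).card ≤ n + 1 :=
  (Finset.card_insert_le _ _).trans
    (Nat.add_le_add_right (Finset.card_image_le.trans (card_turns_le hG hGE hD hw)) 1)

/-- Vertices following each other on a geodesic stay near the geodesic `w` going upwards. -/
theorem IsGeodesic.near_of_le (hG : G.Connected) (hF : TailFree n G) (hn : 0 < n)
    (hw : IsGeodesic G r w d) (hw' : IsGeodesic G r w' d') {k l : ℕ} (hk : n + 2 ≤ k)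
    (hkl : k ≤ l) (hl : l ≤ d') (hld : l + n + 1 ≤ d) (h : Near G r w (w' k)) :
    Near G r w (w' l) := by
  induction l, hkl using Nat.le_induction with
  | base => exact h
  | succ l hkl ih =>
    have hdist := hw'.dist_eq l (by omega)
    exact (ih (by omega) (by omega)).of_adj hG hF hn hw (by omega) (by omega)
      (hw'.adj l (by omega))

/-- Vertices following each other on a geodesic stay near the geodesic `w` going downwards. -/
theorem IsGeodesic.near_of_ge (hG : G.Connected) (hF : TailFree n G) (hn : 0 < n)
    (hw : IsGeodesic G r w d) (hw' : IsGeodesic G r w' d') {k l : ℕ} (hk : n + 1 ≤ k)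
    (hkl : k ≤ l) (hl : l ≤ d') (hld : l + n + 2 ≤ d) (h : Near G r w (w' l)) :
    Near G r w (w' k) := by
  induction l, hkl using Nat.le_induction with
  | base => exact h
  | succ l hkl ih =>
    have hdist := hw'.dist_eq (l + 1) (by omega)
    exact ih (by omega) (by omega) (h.of_adj hG hF hn hw (by omega) (by omega)
      (hw'.adj l (by omega)).symm)

theorem Near.dist_le {v : V} (h : Near G r w v) :
    G.dist (w (G.dist r v)) v ≤ 1 := by
  rcases h with h | h
  · rw [← h]
    simp
  · exact (SimpleGraph.dist_eq_one_iff_adj.mpr h.symm).le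

/-- The distance from a vertex of a geodesic to a vertex near the geodesic. -/
theorem Near.dist_le_of_level (hG : G.Connected) (hw : IsGeodesic G r w d) {v : V}
    (h : Near G r w v) (hv : G.dist r v ≤ d) {t : ℕ} (ht : t ≤ d) :
    G.dist (w t) v ≤ (G.dist r v - t) + (t - G.dist r v) + 1 := by
  have h₁ := hG.dist_triangle (u := w t) (v := w (G.dist r v)) (w := v)
  have h₂ := h.dist_le
  rcases le_total t (G.dist r v) with h₃ | h₃
  · have := hw.dist_le hG h₃ hv
    omega
  · have := hw.dist_le hG h₃ ht
    rw [SimpleGraph.dist_comm] at this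
    omega

/-- The vertices near a best geodesic, except those close to its ends and its turns, lie in a
union of few disjoint directed paths consisting of vertices near the geodesic. -/
theorem IsBestGeodesic.exists_hasPathPartition [Fintype V] (hG : G.Connected)
    (hF : TailFree n G) (hn : 0 < n) (hGE : ∀ u v, G.Adj u v ↔ E u v ∨ E v u)
    (hE : ∀ u v, E u v → ¬ E v u) (hD : CondD2 n E) (hD' : CondD3 n E)
    (hw : IsBestGeodesic G r E (n + 2) w d) :
    ∃ X : Set V, HasPathPartition E X (n + 1) ∧
      (∀ v ∈ X, Near G r w v ∧ n + 2 ≤ G.dist r v ∧ G.dist r v + n + 2 ≤ d) ∧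
      ∀ v, Near G r w v → G.dist r v ≤ d → 2 * n + 5 < G.dist r v →
        (∀ t ∈ insert d (cuts E w d), 2 * n + 5 < G.dist (w t) v) → v ∈ X := by
  classical
  have hgeo := hw.toIsGeodesic
  have hKd := hw.le
  have hnext : ∀ s ∈ cuts E w d, ∃ t ∈ insert d (cuts E w d), s < t ∧
      ∀ t' ∈ insert d (cuts E w d), s < t' → t ≤ t' := by
    intro s hs
    have hsd := le_of_mem_cuts hs
    obtain ⟨t, ht, hmin⟩ := ((insert d (cuts E w d)).filter (s < ·)).exists_min_image id
      ⟨d, by simp; omega⟩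
    simp only [Finset.mem_filter, id] at ht hmin
    exact ⟨t, ht.1, ht.2, fun t' h₁ h₂ => hmin t' ⟨h₁, h₂⟩⟩
  have hpiece : ∀ s ∈ cuts E w d, ∃ l : List V, ∃ t ∈ insert d (cuts E w d), s < t ∧
      (∀ t' ∈ insert d (cuts E w d), s < t' → t ≤ t') ∧ t ≤ d ∧ l.Nodup ∧ l.IsChain E ∧
      (∀ v ∈ l, Near G r w v ∧ s + (n + 2) + n + 2 ≤ G.dist r v ∧ G.dist r v + n + 3 ≤ t) ∧
      ∀ v, Near G r w v → s + (n + 2) + n + 3 ≤ G.dist r v → G.dist r v + n + 4 ≤ t → v ∈ l := by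
    intro s hs
    obtain ⟨t, ht, hst, hmin⟩ := hnext s hs
    have htd : t ≤ d := by
      rcases Finset.mem_insert.mp ht with h | h
      · exact h.le
      · rcases le_of_mem_cuts h with h | h <;> omega
    obtain ⟨l, hl⟩ := hgeo.exists_list_of_forall_not_turn hG hF hn hGE hE hD
      (K := n + 2) (lo := s + (n + 2)) (by omega) htd hw.card_turns_le fun i h₁ h₂ h => by
        have : i + 1 ∈ cuts E w d := Finset.mem_insert_of_mem
          (Finset.mem_image_of_mem _ (mem_turns.mpr ⟨by omega, h⟩))
        have := hmin (i + 1) (Finset.mem_insert_of_mem this) (by omega)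
        omega
    exact ⟨l, t, ht, hst, hmin, htd, hl⟩
  choose! l t ht hst hmin htd hnd hch hl hcov using hpiece
  refine ⟨⋃ s ∈ cuts E w d, {v | v ∈ l s}, ?_, fun v hv => ?_, fun v hv hvd hlev hfar => ?_⟩
  · refine (HasPathPartition.biUnion (cuts E w d) (fun s => {v | v ∈ l s})
      (fun s hs => .of_list (l s) (hnd s hs) (hch s hs) fun v => Iff.rfl)
      fun s hs s' hs' hne => ?_).mono (by simpa using card_cuts_le hG hGE hD' hgeo)
    refine Set.disjoint_left.mpr fun v hv hv' => ?_
    have h₁ := hl s hs v hv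
    have h₂ := hl s' hs' v hv'
    rcases Nat.lt_or_gt_of_ne hne with h | h
    · have := hmin s hs s' (Finset.mem_insert_of_mem hs') h
      omega
    · have := hmin s' hs' s (Finset.mem_insert_of_mem hs) h
      omega
  · simp only [Set.mem_iUnion] at hv
    obtain ⟨s, hs, hv⟩ := hv
    have h₁ := hl s hs v hv
    have h₂ := htd s hs
    exact ⟨h₁.1, by omega, by omega⟩
  · have hgap : ∀ t ∈ insert d (cuts E w d), t ≤ d →
        t + (2 * n + 5) ≤ G.dist r v ∨ G.dist r v + (2 * n + 5) ≤ t := by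
      intro t h₁ h₂
      have h₃ := hfar t h₁
      have h₄ := hv.dist_le_of_level hG hgeo hvd h₂
      omega
    obtain ⟨s, hs, hmax⟩ := ((cuts E w d).filter (· ≤ G.dist r v)).exists_max_image id
      ⟨0, by simp [cuts]⟩
    simp only [Finset.mem_filter, id] at hs hmax
    obtain ⟨hs, hsv⟩ := hs
    have hlt : G.dist r v < t s := by
      by_contra! hle
      have h₁ := hst s hs
      rcases Finset.mem_insert.mp (ht s hs) with h | h
      · have := hgap d (Finset.mem_insert_self _ _) le_rfl
        omega
      · have := hmax (t s) ⟨h, hle⟩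
        omega
    have h₁ := hgap s (Finset.mem_insert_of_mem hs) ((hst s hs).le.trans (htd s hs))
    have h₂ := hgap (t s) (ht s hs) (htd s hs)
    simp only [Set.mem_iUnion]
    exact ⟨s, hs, hcov s hs v hv (by omega) (by omega)⟩

/-- The vertices near two best geodesics that are apart at the level `n + 2` are disjoint. -/
theorem IsBestGeodesic.adj_of_near (hG : G.Connected) (hF : TailFree n G) (hn : 0 < n)
    (hw : IsBestGeodesic G r E (n + 2) w d) (hw' : IsBestGeodesic G r E (n + 2) w' d') {v : V}
    (hv : n + 2 ≤ G.dist r v) (hvd : G.dist r v + n + 2 ≤ d) (hvd' : G.dist r v ≤ d')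
    (h : Near G r w v) (h' : Near G r w' v) :
    w' (n + 2) = w (n + 2) ∨ G.Adj (w' (n + 2)) (w (n + 2)) := by
  have hnear : Near G r w (w' (G.dist r v)) := by
    rcases h' with h' | h'
    · rwa [← h']
    · exact h.of_adj hG hF hn hw.toIsGeodesic hv hvd h'
  have := hw.toIsGeodesic.near_of_ge hG hF hn hw'.toIsGeodesic (k := n + 2) (by omega) hv hvd'
    hvd hnear
  rwa [Near, hw'.dist_eq _ hw'.le] at this

/-- A vertex whose geodesic from `r` starts near `w` is near `w` or close to the end of `w`. -/
theorem IsGeodesic.near_or_dist_le (hG : G.Connected) (hF : TailFree n G) (hn : 0 < n)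
    (hw : IsGeodesic G r w d) (hw' : IsGeodesic G r w' d') (hd : d' ≤ d) (hd' : 2 * n + 5 < d')
    (h : w' (n + 2) = w (n + 2) ∨ G.Adj (w' (n + 2)) (w (n + 2))) :
    Near G r w (w' d') ∨ G.dist (w d) (w' d') ≤ 2 * n + 5 := by
  have hstart : Near G r w (w' (n + 2)) := by
    rwa [Near, hw'.dist_eq _ (by omega)]
  by_cases hle : d' + n + 1 ≤ d
  · exact Or.inl (hw.near_of_le hG hF hn hw' le_rfl (by omega) le_rfl hle hstart)
  · right
    obtain ⟨k, rfl⟩ : ∃ k, d = k + n + 1 := ⟨d - n - 1, by omega⟩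
    have hk := hw.near_of_le hG hF hn hw' le_rfl (l := k) (by omega) (by omega) le_rfl hstart
    have hlev := hw'.dist_eq k (by omega)
    have h₁ := hk.dist_le_of_level hG hw (by omega) (t := k + n + 1) le_rfl
    have h₂ := hw'.dist_le hG (i := k) (j := d') (by omega) le_rfl
    have h₃ := hG.dist_triangle (u := w (k + n + 1)) (v := w' k) (w := w' d')
    omega

end System

/-- For every `n ≥ 2` there is a constant `c′₁ = c′₁(n)` such that
`pp(D) ≤ c′₁` for every weakly connected digraph `D` satisfying (D'1), (D2) and (D3). -/
theorem pp_bounded_of_D1'_D2_D3 (n : ℕ) (hn : 2 ≤ n) :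
    ∃ c : ℕ, ∀ (V : Type) (_ : Fintype V) (E : V → V → Prop),
      (∀ u v : V, E u v → ¬ E v u) →
      (SimpleGraph.fromRel E).Connected →
      CondD1' n E → CondD2 n E → CondD3 n E →
      ppOn E Set.univ ≤ c := by
  classical
  obtain ⟨M, hM⟩ := exists_indepBound_distBall n hn 1 (n + 2)
  obtain ⟨M', hM'⟩ := exists_indepBound_distBall n hn (M * (n + 2) + 1) (2 * n + 5)
  refine ⟨M * (n + 1) + M', fun V _ E hE hG hD₁ hD₂ hD₃ => ?_⟩
  set G := SimpleGraph.fromRel E with hGdef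
  obtain ⟨⟨hK, hS, hF₁, hF₂⟩, hF₃, hF₄⟩ := hD₁
  have hF : TailFree n G := ⟨hF₁, hF₂, hF₃, hF₄⟩
  have hGE : ∀ u v, G.Adj u v ↔ E u v ∨ E v u := fun u v => by
    rw [hGdef, SimpleGraph.fromRel_adj, and_iff_right_iff_imp]
    rintro h rfl
    exact hE u u (h.elim id id) (h.elim id id)
  have hn₀ : 0 < n := by omega
  obtain ⟨r⟩ := hG.nonempty
  have hbest : ∀ y, ∃ w d, G.dist r y = n + 2 → IsBestGeodesic G r E (n + 2) w d ∧ w (n + 2) = y :=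
    fun y => by
      by_cases hy : G.dist r y = n + 2
      · obtain ⟨w, d, h⟩ := exists_isBestGeodesic hG r E hy
        exact ⟨w, d, fun _ => h⟩
      · exact ⟨fun _ => r, 0, fun h => absurd h hy⟩
  choose w d hbest using hbest
  obtain ⟨I, hIL, hI, hdom⟩ := exists_indepSet_dominating G d
    (Finset.univ.filter fun y => G.dist r y = n + 2)
  have hIr : ∀ y ∈ I, G.dist r y = n + 2 := fun y hy => (Finset.mem_filter.mp (hIL hy)).2
  have hIM : I.card ≤ M := hM V G hG hK hS {r} (by simp) I
    (fun y hy => ⟨r, by simp, (hIr y hy).le⟩) hI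
  have hpart : ∀ y ∈ I, ∃ X : Set V, HasPathPartition E X (n + 1) ∧
      (∀ v ∈ X, Near G r (w y) v ∧ n + 2 ≤ G.dist r v ∧ G.dist r v + n + 2 ≤ d y) ∧
      ∀ v, Near G r (w y) v → G.dist r v ≤ d y → 2 * n + 5 < G.dist r v →
        (∀ t ∈ insert (d y) (cuts E (w y) (d y)), 2 * n + 5 < G.dist (w y t) v) → v ∈ X :=
    fun y hy => (hbest y (hIr y hy)).1.exists_hasPathPartition hG hF hn₀ hGE hE hD₂ hD₃
  choose! X hX hnear hcov using hpart
  have hU : HasPathPartition E (⋃ y ∈ I, X y) (M * (n + 1)) := by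
    refine (HasPathPartition.biUnion I X hX fun y hy y' hy' hne => ?_).mono
      (Nat.mul_le_mul_right _ hIM)
    refine Set.disjoint_left.mpr fun v hv hv' => ?_
    have h₁ := hnear y hy v hv
    have h₂ := hnear y' hy' v hv'
    have hb := hbest y (hIr y hy)
    have hb' := hbest y' (hIr y' hy')
    have := hb.1.adj_of_near hG hF hn₀ hb'.1 h₁.2.1 h₁.2.2 (by omega) h₁.1 h₂.1
    rw [hb.2, hb'.2] at this
    exact this.elim hne.symm (hI hy' hy hne.symm)
  set Z : Finset V := insert r (I.biUnion fun y =>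
    (insert (d y) (cuts E (w y) (d y))).image (w y)) with hZ
  have hZcard : Z.card ≤ M * (n + 2) + 1 := by
    refine (Finset.card_insert_le _ _).trans (Nat.add_le_add_right ?_ 1)
    refine (Finset.card_biUnion_le_card_mul I _ (n + 2) fun y hy => ?_).trans
      (Nat.mul_le_mul_right _ hIM)
    refine Finset.card_image_le.trans ((Finset.card_insert_le _ _).trans ?_)
    exact Nat.add_le_add_right
      (card_cuts_le hG hGE hD₃ (hbest y (hIr y hy)).1.toIsGeodesic) 1
  have hW : HasPathPartition E (⋃ y ∈ I, X y)ᶜ M' := by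
    refine .of_indepBound (fun u v => (hGE u v).mp)
      ((hM' V G hG hK hS Z hZcard).mono fun v hv => ?_)
    by_contra hvZ
    have hfar : ∀ z ∈ Z, 2 * n + 5 < G.dist z v := fun z hz =>
      not_le.mp fun h => hvZ ⟨z, hz, h⟩
    have hr := hfar r (Finset.mem_insert_self _ _)
    obtain ⟨w', hw', hw'v⟩ := IsGeodesic.exists_of_dist hG r _ v rfl
    have hx := hw'.dist_eq (n + 2) (by omega)
    obtain ⟨y, hy, hxy, hle⟩ := hdom (w' (n + 2)) (by simp [hx])
    have hb := hbest y (hIr y hy)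
    have hbx := hbest _ hx
    have hlev := (hbx.1.length_le w' _ hw' (by omega) hbx.2.symm).trans hle
    have hfar' : ∀ t ∈ insert (d y) (cuts E (w y) (d y)), 2 * n + 5 < G.dist (w y t) v :=
      fun t ht => hfar _ (Finset.mem_insert_of_mem
        (Finset.mem_biUnion.mpr ⟨y, hy, Finset.mem_image_of_mem _ ht⟩))
    have hvn : Near G r (w y) v := by
      have := hb.1.toIsGeodesic.near_or_dist_le hG hF hn₀ hw' hlev hr (by rwa [hb.2])
      rw [hw'v] at this
      exact this.resolve_right (not_le.mpr (hfar' _ (Finset.mem_insert_self _ _)))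
    refine hv ?_
    simp only [Set.mem_iUnion]
    exact ⟨y, hy, hcov y hy v hvn hlev hr hfar'⟩
  have := hU.union hW disjoint_compl_right
  rw [Set.union_compl_self] at this
  exact this.ppOn_le
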